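/- Let K ⊆ Sym(3) be a non-empty compact set of real symmetric 3×3 matrices. Then for every p with 1 ≤ p < ∞ one has K^(p) = K^(∞); in particular all the hulls K^(p), 1 ≤ p ≤ ∞, coincide. -/

import Mathlib

/-!
Symmetric div-quasiconvex hulls of compact sets of symmetric 3×3 matrices.

`M33` encodes the real 3×3 matrices with the Frobenius norm, as the Euclidean
space indexed by `Fin 3 × Fin 3`; symmetric matrices are singled out by the
predicate `IsSym3`.  The torus `𝕋₃ = ℝ³/ℤ³` is encoded via `ℤ³`-periodic
functions on `ℝ³` (with the unit cube `unitBox` as fundamental domain, of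
measure one, so integrals over `unitBox` are the normalized torus integrals).
-/

noncomputable section
open MeasureTheory

/-- 3×3 real matrices with the Frobenius norm. -/
abbrev M33 : Type := EuclideanSpace ℝ (Fin 3 × Fin 3)

/-- The underlying space `ℝ³` of the torus `𝕋₃ = ℝ³/ℤ³`. -/
abbrev Dom3 : Type := Fin 3 → ℝ

/-- A 3×3 matrix is symmetric. -/
def IsSym3 (A : M33) : Prop := ∀ i j : Fin 3, A (i, j) = A (j, i)

/-- The fundamental domain `[0,1)³` of the torus. -/
def unitBox : Set Dom3 := Set.univ.pi fun _ => Set.Ico (0 : ℝ) 1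

/-- `ℤ³`-periodicity: the defining property of functions on the torus `𝕋₃`. -/
def PeriodicZ3 {E : Type*} (φ : Dom3 → E) : Prop :=
  ∀ (x : Dom3) (m : Fin 3 → ℤ), φ (x + fun i => (m i : ℝ)) = φ x

/-- Pointwise row-wise divergence-freeness of a (smooth) matrix field. -/
def DivFree3 (φ : Dom3 → M33) : Prop :=
  ∀ (x : Dom3) (α : Fin 3),
    ∑ β : Fin 3, fderiv ℝ (fun y => φ y (α, β)) x (Pi.single β 1) = 0

/-- The test class `𝒯`: smooth maps `φ : 𝕋₃ → Sym(3)` with zero mean and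
`div φ = 0` (row-wise). -/
def TestClass : Set (Dom3 → M33) :=
  {φ | ContDiff ℝ (⊤ : ℕ∞) φ ∧ PeriodicZ3 φ ∧ (∀ x, IsSym3 (φ x)) ∧ DivFree3 φ ∧
    (∫ x in unitBox, φ x) = 0}

/-- `F : Sym(3) → ℝ` is symmetric div-quasiconvex if
`F ξ ≤ ∫_{𝕋₃} F (ξ + φ x) dx` for all symmetric `ξ` and all `φ ∈ 𝒯`. -/
def SymDivQC (F : M33 → ℝ) : Prop :=
  ∀ ξ : M33, IsSym3 ξ → ∀ φ ∈ TestClass, F ξ ≤ ∫ x in unitBox, F (ξ + φ x)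

/-- The symmetric div-quasiconvex envelope
`𝒬F(ξ) = inf { ∫_{𝕋₃} F(ξ + φ(x)) dx : φ ∈ 𝒯 }`. -/
def sdqcEnvelope (F : M33 → ℝ) (ξ : M33) : ℝ :=
  sInf ((fun φ : Dom3 → M33 => ∫ x in unitBox, F (ξ + φ x)) '' TestClass)

/-- The `p`-symmetric div-quasiconvex hull
`K^(p) = { ξ ∈ Sym(3) : 𝒬f_p(ξ) = 0 }` with `f_p(ξ) = dist(ξ,K)^p`. -/
def hullP (K : Set M33) (p : ℝ) : Set M33 :=
  {ξ | IsSym3 ξ ∧ sdqcEnvelope (fun η => Metric.infDist η K ^ p) ξ = 0}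

/-- The `∞`-symmetric div-quasiconvex hull: all symmetric `ξ` with
`g ξ ≤ max_K g` for every symmetric div-quasiconvex continuous
`g : Sym(3) → [0,∞)`. -/
def hullInf (K : Set M33) : Set M33 :=
  {ξ | IsSym3 ξ ∧ ∀ g : M33 → ℝ, Continuous g → (∀ η, 0 ≤ g η) → SymDivQC g →
    g ξ ≤ sSup (g '' K)}

section Helpers
open Set Filter Topology Function
open scoped ContDiff

section ParametricIntegral

variable {E F H : Type} [NormedAddCommGroup E] [NormedSpace ℝ E]
  [NormedAddCommGroup F] [NormedSpace ℝ F] [NormedAddCommGroup H] [NormedSpace ℝ H]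

theorem contDiff_fderiv_param {G : E → F → H} (hG : ContDiff ℝ ∞ (uncurry G)) :
    ContDiff ℝ ∞ (uncurry fun x z => fderiv ℝ (fun y => G y z) x) := by
  have h : ContDiff ℝ ∞ (uncurry fun (q : E × F) (y : E) => G y q.2) :=
    hG.comp (contDiff_snd.prodMk (contDiff_snd.comp contDiff_fst))
  exact h.fderiv (n := ∞) contDiff_fst (by simp)

variable [ProperSpace E] [MeasurableSpace F] [BorelSpace F] [SecondCountableTopology F]

theorem hasFDerivAt_setIntegral_of_contDiff {G : E → F → H} (hG : ContDiff ℝ ∞ (uncurry G))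
    (μ : Measure F) [IsLocallyFiniteMeasure μ] {S : Set F} (hS : IsCompact S) (x : E) :
    HasFDerivAt (fun x => ∫ z in S, G x z ∂μ)
      (∫ z in S, fderiv ℝ (fun y => G y z) x ∂μ) x := by
  have hG' := (contDiff_fderiv_param hG).continuous
  have hc : ∀ y, Continuous (G y) := fun y =>
    hG.continuous.comp (f := fun z => (y, z)) (by fun_prop)
  have hc' : ∀ y, Continuous fun z => fderiv ℝ (fun y => G y z) y := fun y =>
    hG'.comp (g := uncurry fun x z => fderiv ℝ (fun y => G y z) x)
      (f := fun z => (y, z)) (by fun_prop)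
  obtain ⟨C, hC⟩ := ((isCompact_closedBall x 1).prod hS).exists_bound_of_continuousOn
    hG'.continuousOn
  have : Fact (μ S < ⊤) := ⟨hS.measure_lt_top⟩
  refine hasFDerivAt_integral_of_dominated_of_fderiv_le (bound := fun _ => C)
    (F' := fun y z => fderiv ℝ (fun y => G y z) y)
    (Metric.closedBall_mem_nhds x one_pos)
    (Eventually.of_forall fun y => (hc y).aestronglyMeasurable)
    ((hc x).continuousOn.integrableOn_compact hS)
    (hc' x).aestronglyMeasurable ?_ (integrable_const C) ?_
  · filter_upwards [ae_restrict_mem₀ hS.measurableSet.nullMeasurableSet] with z hz y hy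
    exact hC (y, z) ⟨hy, hz⟩
  · refine Eventually.of_forall fun z y _ => ?_
    have : ContDiff ℝ ∞ fun y => G y z := hG.comp (contDiff_id.prodMk contDiff_const)
    exact (this.differentiable (by simp) y).hasFDerivAt

theorem contDiff_setIntegral_of_contDiff {G : E → F → H} (hG : ContDiff ℝ ∞ (uncurry G))
    (μ : Measure F) [IsLocallyFiniteMeasure μ] {S : Set F} (hS : IsCompact S) :
    ContDiff ℝ ∞ (fun x => ∫ z in S, G x z ∂μ) := by
  rw [contDiff_infty]
  intro n
  induction n generalizing H with
  | zero =>
    exact contDiff_zero.mpr (continuous_iff_continuousAt.mpr fun x =>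
      (hasFDerivAt_setIntegral_of_contDiff hG μ hS x).continuousAt)
  | succ n ih =>
    rw [Nat.cast_add, Nat.cast_one, contDiff_succ_iff_hasFDerivAt]
    exact ⟨_, ih (contDiff_fderiv_param hG),
      hasFDerivAt_setIntegral_of_contDiff hG μ hS⟩

end ParametricIntegral

section PartialDerivative

/-- The `i`-th partial derivative of a scalar function on `ℝ³`. -/
def pd (i : Fin 3) (f : Dom3 → ℝ) (x : Dom3) : ℝ := fderiv ℝ f x (Pi.single i 1)

variable {f g : Dom3 → ℝ}

theorem contDiff_pd (hf : ContDiff ℝ ∞ f) (i : Fin 3) : ContDiff ℝ ∞ (pd i f) :=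
  (hf.fderiv_right (m := ∞) (by simp)).clm_apply contDiff_const

theorem pd_add (hf : ContDiff ℝ ∞ f) (hg : ContDiff ℝ ∞ g) (i : Fin 3) (x : Dom3) :
    pd i (fun y => f y + g y) x = pd i f x + pd i g x := by
  simp [pd, fderiv_fun_add (hf.differentiable (by simp) x) (hg.differentiable (by simp) x)]

theorem pd_sub (hf : ContDiff ℝ ∞ f) (hg : ContDiff ℝ ∞ g) (i : Fin 3) (x : Dom3) :
    pd i (fun y => f y - g y) x = pd i f x - pd i g x := by
  simp [pd, fderiv_fun_sub (hf.differentiable (by simp) x) (hg.differentiable (by simp) x)]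

theorem pd_mul (hf : ContDiff ℝ ∞ f) (hg : ContDiff ℝ ∞ g) (i : Fin 3) (x : Dom3) :
    pd i (fun y => f y * g y) x = pd i f x * g x + f x * pd i g x := by
  simp [pd, fderiv_fun_mul (hf.differentiable (by simp) x) (hg.differentiable (by simp) x)]
  ring

theorem pd_const_mul (c : ℝ) (hf : ContDiff ℝ ∞ f) (i : Fin 3) (x : Dom3) :
    pd i (fun y => c * f y) x = c * pd i f x := by
  simp [pd, fderiv_const_mul (hf.differentiable (by simp) x)]

theorem pd_const (c : ℝ) (i : Fin 3) (x : Dom3) : pd i (fun _ => c) x = 0 := by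
  simp [pd]

theorem pd_sum {ι : Type*} (s : Finset ι) {f : ι → Dom3 → ℝ} (hf : ∀ j, ContDiff ℝ ∞ (f j))
    (i : Fin 3) (x : Dom3) :
    pd i (fun y => ∑ j ∈ s, f j y) x = ∑ j ∈ s, pd i (f j) x := by
  simp [pd, fderiv_fun_sum fun j _ => (hf j).differentiable (by simp) x]

theorem pd_comm (hf : ContDiff ℝ ∞ f) (i j : Fin 3) (x : Dom3) :
    pd i (pd j f) x = pd j (pd i f) x := by
  have hd : DifferentiableAt ℝ (fderiv ℝ f) x :=
    (hf.fderiv_right (m := ∞) (by simp)).differentiable (by simp) x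
  have hs : IsSymmSndFDerivAt ℝ f x := hf.contDiffAt.isSymmSndFDerivAt (by simp; decide)
  have key : ∀ a b : Fin 3,
      pd a (pd b f) x = fderiv ℝ (fderiv ℝ f) x (Pi.single a 1) (Pi.single b 1) := by
    intro a b
    change fderiv ℝ (fun y => fderiv ℝ f y (Pi.single b 1)) x (Pi.single a 1) = _
    rw [fderiv_clm_apply hd (differentiableAt_const _)]
    simp
  rw [key, key]
  exact hs _ _

/-- A linear functional on `ℝ³` is determined by the standard basis. -/
theorem clm_apply_eq_sum {H : Type*} [NormedAddCommGroup H] [NormedSpace ℝ H]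
    (L : Dom3 →L[ℝ] H) (v : Dom3) : L v = ∑ k, v k • L (Pi.single k 1) := by
  conv_lhs => rw [← Finset.univ_sum_single v]
  rw [map_sum]
  refine Finset.sum_congr rfl fun k _ => ?_
  rw [← map_smul]
  congr 1
  ext j
  simp [Pi.single_apply]

theorem pd_comp {Φ : Dom3 → Dom3} (hf : ContDiff ℝ ∞ f) (hΦ : ContDiff ℝ ∞ Φ)
    (i : Fin 3) (x : Dom3) :
    pd i (fun y => f (Φ y)) x = ∑ k, pd i (fun y => Φ y k) x * pd k f (Φ x) := by
  have h1 := hΦ.differentiable (by simp) x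
  have h2 := hf.differentiable (by simp) (Φ x)
  change fderiv ℝ (f ∘ Φ) x (Pi.single i 1) = _
  rw [fderiv_comp x h2 h1, ContinuousLinearMap.comp_apply, clm_apply_eq_sum]
  refine Finset.sum_congr rfl fun k _ => ?_
  have : fderiv ℝ (fun y => Φ y k) x = (ContinuousLinearMap.proj k).comp (fderiv ℝ Φ x) :=
    ((ContinuousLinearMap.proj (R := ℝ) (φ := fun _ : Fin 3 => ℝ) k).hasFDerivAt.comp x
      h1.hasFDerivAt).fderiv
  simp [pd, this]

theorem pd_congr {x : Dom3} (h : f =ᶠ[𝓝 x] g) (i : Fin 3) : pd i f x = pd i g x := by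
  simp [pd, h.fderiv_eq]

end PartialDerivative

section Periodic

theorem isAddFundamentalDomain_unitBox :
    IsAddFundamentalDomain (Submodule.span ℤ (Set.range (Pi.basisFun ℝ (Fin 3)))) unitBox
      (volume : Measure Dom3) := by
  convert ZSpan.isAddFundamentalDomain (Pi.basisFun ℝ (Fin 3)) (volume : Measure Dom3) using 1
  ext x
  simp [unitBox]

instance vaddInvariantMeasure_span :
    VAddInvariantMeasure (Submodule.span ℤ (Set.range (Pi.basisFun ℝ (Fin 3)))) Dom3 volume :=
  ⟨fun c _ _ => measure_preimage_add volume (c : Dom3) _⟩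

theorem measurableSet_unitBox : MeasurableSet unitBox :=
  MeasurableSet.univ_pi fun _ => measurableSet_Ico

theorem volume_unitBox : volume unitBox = 1 := by
  rw [unitBox, volume_pi_pi]
  simp

theorem PeriodicZ3.span_vadd {X : Type*} {f : Dom3 → X} (hf : PeriodicZ3 f)
    (g : Submodule.span ℤ (Set.range (Pi.basisFun ℝ (Fin 3)))) (x : Dom3) : f (g +ᵥ x) = f x := by
  obtain ⟨m, hm⟩ := (Submodule.mem_span_range_iff_exists_fun ℤ).mp g.2
  have h : g +ᵥ x = x + fun i => (m i : ℝ) := by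
    change (g : Dom3) + x = _
    rw [add_comm, ← hm]
    ext i
    simp [Finset.sum_apply, Pi.single_apply]
  rw [h, hf]

theorem setIntegral_unitBox_add {H : Type*} [NormedAddCommGroup H] [NormedSpace ℝ H]
    {f : Dom3 → H} (hf : PeriodicZ3 f) (v : Dom3) :
    ∫ x in unitBox, f (x + v) = ∫ x in unitBox, f x := by
  have h := (isAddFundamentalDomain_unitBox.vadd_of_comm v).setIntegral_eq
    isAddFundamentalDomain_unitBox hf.span_vadd
  rw [← h, ← image_vadd, (measurePreserving_vadd v (volume : Measure Dom3)).setIntegral_image_emb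
      (measurableEmbedding_const_vadd v)]
  simp [add_comm]

end Periodic

section Transport

/-- Derivative along a constant vector field. -/
def dirDeriv (z : Dom3) (f : Dom3 → ℝ) (x : Dom3) : ℝ := ∑ k, z k * pd k f x

theorem contDiff_dirDeriv (z : Dom3) {f : Dom3 → ℝ} (hf : ContDiff ℝ ∞ f) :
    ContDiff ℝ ∞ (dirDeriv z f) :=
  ContDiff.sum fun k _ => contDiff_const.mul (contDiff_pd hf k)

theorem pd_dirDeriv (z : Dom3) {f : Dom3 → ℝ} (hf : ContDiff ℝ ∞ f) (i : Fin 3) (x : Dom3) :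
    pd i (dirDeriv z f) x = dirDeriv z (pd i f) x := by
  unfold dirDeriv
  rw [pd_sum _ fun k => contDiff_const.mul (contDiff_pd hf k)]
  refine Finset.sum_congr rfl fun k _ => ?_
  rw [pd_const_mul _ (contDiff_pd hf k), pd_comm hf]

theorem dirDeriv_add (z : Dom3) {f g : Dom3 → ℝ} (hf : ContDiff ℝ ∞ f) (hg : ContDiff ℝ ∞ g)
    (x : Dom3) : dirDeriv z (fun y => f y + g y) x = dirDeriv z f x + dirDeriv z g x := by
  simp only [dirDeriv, pd_add hf hg, mul_add, Finset.sum_add_distrib]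

theorem dirDeriv_sum (z : Dom3) {ι : Type*} (s : Finset ι) {f : ι → Dom3 → ℝ}
    (hf : ∀ j, ContDiff ℝ ∞ (f j)) (x : Dom3) :
    dirDeriv z (fun y => ∑ j ∈ s, f j y) x = ∑ j ∈ s, dirDeriv z (f j) x := by
  simp only [dirDeriv, pd_sum s hf, Finset.mul_sum]
  exact Finset.sum_comm

/-- The adjugate of `1 + z ⊗ p`. -/
def shiftAdj (z p : Fin 3 → ℝ) (α γ : Fin 3) : ℝ :=
  (1 + ∑ k, z k * p k) * (if α = γ then 1 else 0) - z α * p γ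

/-- The zeroth order coefficients of the transport of symmetric divergence-free fields. -/
def shiftCoef (z : Fin 3 → ℝ) (Q : Fin 3 → Fin 3 → ℝ) (α β γ δ : Fin 3) : ℝ :=
  (1 - ∑ i, ∑ j, z i * z j * Q i j) * (if α = γ then 1 else 0) * (if β = δ then 1 else 0)
    + z α * (if β = γ then 1 else 0) * (∑ j, Q δ j * z j)
    + z β * (if α = γ then 1 else 0) * (∑ j, Q δ j * z j) - z α * z β * Q γ δ

/-- The algebraic form of the transport: `f` is the value and `f'` the radial derivative of the
transported field, `p` and `Q` are the first and second order data of the scale function. -/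
def shiftForm (z p : Fin 3 → ℝ) (Q f f' : Fin 3 → Fin 3 → ℝ) (α β : Fin 3) : ℝ :=
  ∑ γ, ∑ δ, (shiftCoef z Q α β γ δ * f γ δ
    - shiftAdj z p α γ * shiftAdj z p β δ * f' γ δ)

/-- Second order data of the scale function: the Hessian of `r ^ 2 / 2`. -/
def scaleHess (r : Dom3 → ℝ) (x : Dom3) (i j : Fin 3) : ℝ :=
  pd i r x * pd j r x + r x * pd i (pd j r) x

/-- Transport of a symmetric field along `x ↦ x + r x • z`. It preserves the symmetric
divergence-free fields. -/
def shiftField (r : Dom3 → ℝ) (φ : Dom3 → M33) (z x : Dom3) (α β : Fin 3) : ℝ :=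
  shiftForm z (fun i => pd i r x) (scaleHess r x) (fun γ δ => φ (x + r x • z) (γ, δ))
    (fun γ δ => r x * dirDeriv z (fun y => φ y (γ, δ)) (x + r x • z)) α β

variable {r : Dom3 → ℝ} {φ : Dom3 → M33}

theorem contDiff_coord (hφ : ContDiff ℝ ∞ φ) (α β : Fin 3) :
    ContDiff ℝ ∞ fun y => φ y (α, β) :=
  contDiff_euclidean.mp hφ (α, β)

theorem DivFree3.sum_pd (hφ : DivFree3 φ) (α : Fin 3) (x : Dom3) :
    ∑ β, pd β (fun y => φ y (α, β)) x = 0 := hφ x α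

theorem contDiff_shift (hr : ContDiff ℝ ∞ r) (z : Dom3) :
    ContDiff ℝ ∞ fun x : Dom3 => x + r x • z :=
  contDiff_id.add (hr.smul contDiff_const)

theorem pd_comp_shift (hr : ContDiff ℝ ∞ r) (z : Dom3) {f : Dom3 → ℝ} (hf : ContDiff ℝ ∞ f)
    (i : Fin 3) (x : Dom3) :
    pd i (fun y => f (y + r y • z)) x
      = pd i f (x + r x • z) + pd i r x * dirDeriv z f (x + r x • z) := by
  rw [pd_comp hf (contDiff_shift hr z)]
  have h : ∀ k, pd i (fun y : Dom3 => (y + r y • z) k) x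
      = (if k = i then 1 else 0) + pd i r x * z k := by
    intro k
    have h1 : ContDiff ℝ ∞ fun y : Dom3 => y k := contDiff_apply _ _ k
    have h2 : pd i (fun y : Dom3 => y k) x = if k = i then 1 else 0 := by
      have := (ContinuousLinearMap.proj (R := ℝ) (φ := fun _ : Fin 3 => ℝ) k).hasFDerivAt
        (x := x) |>.fderiv
      simp only [pd]
      erw [this]
      simp [Pi.single_apply]
    have h3 : (fun y : Dom3 => (y + r y • z) k) = fun y => y k + z k * r y := by
      ext y; simp [mul_comm]
    rw [h3, pd_add h1 (contDiff_const.mul hr), pd_const_mul _ hr, h2]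
    ring
  simp only [h, add_mul, Finset.sum_add_distrib, dirDeriv, Finset.mul_sum]
  simp [mul_assoc]

section Structure

variable (r φ) (z : Dom3)

/-- The components of `φ` at the shifted point. -/
def shSt (α β : Fin 3) (x : Dom3) : ℝ := φ (x + r x • z) (α, β)

def shDet (x : Dom3) : ℝ := 1 + dirDeriv z r x

def shFlux (α : Fin 3) (x : Dom3) : ℝ := ∑ i, shSt r φ z α i x * pd i r x

variable {r φ}

theorem contDiff_shSt (hr : ContDiff ℝ ∞ r) (hφ : ContDiff ℝ ∞ φ) (α β : Fin 3) :
    ContDiff ℝ ∞ (shSt r φ z α β) :=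
  (contDiff_coord hφ α β).comp (contDiff_shift hr z)

theorem contDiff_shDet (hr : ContDiff ℝ ∞ r) : ContDiff ℝ ∞ (shDet r z) :=
  contDiff_const.add (contDiff_dirDeriv z hr)

theorem contDiff_shFlux (hr : ContDiff ℝ ∞ r) (hφ : ContDiff ℝ ∞ φ) (α : Fin 3) :
    ContDiff ℝ ∞ (shFlux r φ z α) :=
  ContDiff.sum fun i _ => (contDiff_shSt z hr hφ α i).mul (contDiff_pd hr i)

theorem pd_shSt (hr : ContDiff ℝ ∞ r) (hφ : ContDiff ℝ ∞ φ) (α β i : Fin 3) (x : Dom3) :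
    pd i (shSt r φ z α β) x = pd i (fun y => φ y (α, β)) (x + r x • z)
      + pd i r x * dirDeriv z (fun y => φ y (α, β)) (x + r x • z) :=
  pd_comp_shift hr z (contDiff_coord hφ α β) i x

theorem pd_shDet (hr : ContDiff ℝ ∞ r) (i : Fin 3) (x : Dom3) :
    pd i (shDet r z) x = ∑ l, z l * pd l (pd i r) x := by
  unfold shDet
  rw [pd_add contDiff_const (contDiff_dirDeriv z hr), pd_const, zero_add, pd_dirDeriv z hr]
  rfl

theorem pd_shFlux (hr : ContDiff ℝ ∞ r) (hφ : ContDiff ℝ ∞ φ) (α i : Fin 3) (x : Dom3) :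
    pd i (shFlux r φ z α) x = ∑ l, (pd i (shSt r φ z α l) x * pd l r x
      + shSt r φ z α l x * pd i (pd l r) x) := by
  unfold shFlux
  rw [pd_sum _ fun i => (contDiff_shSt z hr hφ α i).mul (contDiff_pd hr i)]
  exact Finset.sum_congr rfl fun l _ => pd_mul (contDiff_shSt z hr hφ α l) (contDiff_pd hr l) i x

theorem sum_pd_det_mul (hr : ContDiff ℝ ∞ r) (hφ : ContDiff ℝ ∞ φ) (hd : DivFree3 φ)
    (α : Fin 3) (x : Dom3) :
    ∑ β, pd β (fun y => shDet r z y * shSt r φ z α β y) x = dirDeriv z (shFlux r φ z α) x := by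
  have h := hd.sum_pd α (x + r x • z)
  simp only [pd_mul (contDiff_shDet z hr) (contDiff_shSt z hr hφ _ _), pd_shDet z hr,
    dirDeriv, pd_shFlux z hr hφ, pd_shSt z hr hφ]
  simp only [shDet, dirDeriv, Fin.sum_univ_three, pd_comm hr 1 0, pd_comm hr 2 0, pd_comm hr 2 1] at h ⊢
  linear_combination (1 + z 0 * pd 0 r x + z 1 * pd 1 r x + z 2 * pd 2 r x) * h

theorem sum_pd_scale_det_mul (hr : ContDiff ℝ ∞ r) (hφ : ContDiff ℝ ∞ φ) (hd : DivFree3 φ)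
    (α : Fin 3) (x : Dom3) :
    ∑ β, pd β (fun y => r y * (shDet r z y * shSt r φ z α β y)) x
      = dirDeriv z (fun y => r y * shFlux r φ z α y) x + shFlux r φ z α x := by
  have h := sum_pd_det_mul z hr hφ hd α x
  simp only [pd_mul hr ((contDiff_shDet z hr).mul (contDiff_shSt z hr hφ _ _)),
    Finset.sum_add_distrib, ← Finset.mul_sum, h]
  simp only [dirDeriv, pd_mul hr (contDiff_shFlux z hr hφ _)]
  simp only [shFlux, shDet, dirDeriv, Fin.sum_univ_three]
  ring

/-- The transported field written as a combination of total derivatives. -/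
def shStruct (r : Dom3 → ℝ) (φ : Dom3 → M33) (z : Dom3) (α β : Fin 3) (x : Dom3) : ℝ :=
  shDet r z x * shSt r φ z α β x
    - dirDeriv z (fun y => r y * (shDet r z y * shSt r φ z α β y)) x
    + z α * dirDeriv z (fun y => r y * shFlux r φ z β y) x
    + z β * dirDeriv z (fun y => r y * shFlux r φ z α y) x
    - z α * z β * ∑ i, pd i (fun y => r y * shFlux r φ z i y) x

end Structure
end Transport

section StructureEquation

variable {r : Dom3 → ℝ} {φ : Dom3 → M33} (z : Dom3)

theorem shiftField_eq_struct (hr : ContDiff ℝ ∞ r) (hφ : ContDiff ℝ ∞ φ) (hd : DivFree3 φ)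
    (hs : ∀ x, IsSym3 (φ x)) (α β : Fin 3) (x : Dom3) :
    shiftField r φ z x α β = shStruct r φ z α β x := by
  have hdiv := fun α => hd.sum_pd α (x + r x • z)
  have e : ∀ α β : Fin 3, (fun y => φ y (α, β)) = fun y => φ y (β, α) := fun α β =>
    funext fun y => hs y α β
  have e1 : ∀ y, φ y (1, 0) = φ y (0, 1) := fun y => hs y _ _
  have e2 : ∀ y, φ y (2, 0) = φ y (0, 2) := fun y => hs y _ _
  have e3 : ∀ y, φ y (2, 1) = φ y (1, 2) := fun y => hs y _ _
  have h0 := hdiv 0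
  have h1 := hdiv 1
  have h2 := hdiv 2
  simp only [Fin.sum_univ_three, e1, e2, e3] at h0 h1 h2
  simp only [shStruct, shiftField, shiftForm, dirDeriv,
    pd_mul hr ((contDiff_shDet z hr).mul (contDiff_shSt z hr hφ _ _)),
    pd_mul (contDiff_shDet z hr) (contDiff_shSt z hr hφ _ _),
    pd_mul hr (contDiff_shFlux z hr hφ _), pd_shDet z hr, pd_shFlux z hr hφ, pd_shSt z hr hφ]
  simp only [shFlux, shSt, shDet, dirDeriv, shiftCoef, shiftAdj, scaleHess, Fin.sum_univ_three,
    e1, e2, e3, pd_comm hr 1 0, pd_comm hr 2 0, pd_comm hr 2 1]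
  have H := congrArg₂ (· + ·) (congrArg₂ (· + ·) (congrArg (pd 0 r x * ·) h0)
    (congrArg (pd 1 r x * ·) h1)) (congrArg (pd 2 r x * ·) h2)
  fin_cases α <;> fin_cases β <;> simp [e1, e2, e3]
  · linear_combination (z 0 * z 0 * r x) * H
  · linear_combination (z 0 * z 1 * r x) * H
  · linear_combination (z 0 * z 2 * r x) * H
  · linear_combination (z 1 * z 0 * r x) * H
  · linear_combination (z 1 * z 1 * r x) * H
  · linear_combination (z 1 * z 2 * r x) * H
  · linear_combination (z 2 * z 0 * r x) * H
  · linear_combination (z 2 * z 1 * r x) * H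
  · linear_combination (z 2 * z 2 * r x) * H

theorem contDiff_shStruct_aux (hr : ContDiff ℝ ∞ r) (hφ : ContDiff ℝ ∞ φ) (α β : Fin 3) :
    ContDiff ℝ ∞ (fun y => r y * (shDet r z y * shSt r φ z α β y)) :=
  hr.mul ((contDiff_shDet z hr).mul (contDiff_shSt z hr hφ _ _))

theorem sum_pd_shStruct (hr : ContDiff ℝ ∞ r) (hφ : ContDiff ℝ ∞ φ) (hd : DivFree3 φ)
    (α : Fin 3) (x : Dom3) :
    ∑ β, pd β (shStruct r φ z α β) x = 0 := by
  have c0 := fun β => (contDiff_shDet z hr).mul (contDiff_shSt z hr hφ α β)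
  have c1 := contDiff_shStruct_aux z hr hφ α
  have c2 : ∀ β, ContDiff ℝ ∞ fun y => r y * shFlux r φ z β y := fun β =>
    hr.mul (contDiff_shFlux z hr hφ β)
  have c3 : ContDiff ℝ ∞ fun x => ∑ i, pd i (fun y => r y * shFlux r φ z i y) x :=
    ContDiff.sum fun i _ => contDiff_pd (c2 i) i
  have a1 := sum_pd_det_mul z hr hφ hd α x
  have a2 : (fun x => ∑ β, pd β (fun y => r y * (shDet r z y * shSt r φ z α β y)) x) =
      fun x => dirDeriv z (fun y => r y * shFlux r φ z α y) x + shFlux r φ z α x :=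
    funext fun x => sum_pd_scale_det_mul z hr hφ hd α x
  have a3 := congrArg (fun f => dirDeriv z f x) a2
  simp only [dirDeriv_add z (contDiff_dirDeriv z (c2 α)) (contDiff_shFlux z hr hφ α),
    dirDeriv_sum z _ fun β => contDiff_pd (c1 β) β] at a3
  have a4 : dirDeriv z (fun x => ∑ i, pd i (fun y => r y * shFlux r φ z i y) x) x
      = ∑ i, dirDeriv z (pd i fun y => r y * shFlux r φ z i y) x :=
    dirDeriv_sum z _ (fun β => contDiff_pd (c2 β) β) x
  have key : ∀ β, pd β (shStruct r φ z α β) x =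
      pd β (fun y => shDet r z y * shSt r φ z α β y) x
      - dirDeriv z (pd β fun y => r y * (shDet r z y * shSt r φ z α β y)) x
      + z α * dirDeriv z (pd β fun y => r y * shFlux r φ z β y) x
      + z β * pd β (dirDeriv z fun y => r y * shFlux r φ z α y) x
      - z α * z β * pd β (fun x => ∑ i, pd i (fun y => r y * shFlux r φ z i y) x) x := by
    intro β
    have d1 := contDiff_dirDeriv z (c1 β)
    have d2 := contDiff_dirDeriv z (c2 β)
    have d3 := contDiff_dirDeriv z (c2 α)
    unfold shStruct
    rw [pd_sub ((((c0 β).sub d1).add (contDiff_const.mul d2)).add (contDiff_const.mul d3))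
      (contDiff_const.mul c3), pd_add (((c0 β).sub d1).add (contDiff_const.mul d2))
      (contDiff_const.mul d3), pd_add ((c0 β).sub d1) (contDiff_const.mul d2),
      pd_sub (c0 β) d1, pd_const_mul _ d2, pd_const_mul _ d3, pd_const_mul _ c3,
      pd_dirDeriv z (c1 β), pd_dirDeriv z (c2 β)]
  have a5 : ∑ β, z β * pd β (dirDeriv z fun y => r y * shFlux r φ z α y) x =
      dirDeriv z (dirDeriv z fun y => r y * shFlux r φ z α y) x := rfl
  have a6 : ∑ β, z β * pd β (fun x => ∑ i, pd i (fun y => r y * shFlux r φ z i y) x) x =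
      ∑ i, dirDeriv z (pd i fun y => r y * shFlux r φ z i y) x := a4
  simp only [key, Finset.sum_add_distrib, Finset.sum_sub_distrib, mul_assoc, ← Finset.mul_sum,
    a5, a6]
  rw [a1, a3]
  ring

end StructureEquation

section BoxIntegral

theorem unitBox_ae_eq_Icc : (unitBox : Set Dom3) =ᵐ[volume] Icc 0 1 := by
  have h := Measure.univ_pi_Ico_ae_eq_Icc (μ := fun _ : Fin 3 => (volume : Measure ℝ))
    (f := fun _ => (0 : ℝ)) (g := fun _ => 1)
  exact h

theorem unitBox_subset_Icc : (unitBox : Set Dom3) ⊆ Icc 0 1 := fun _ hx =>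
  ⟨fun i => (hx i trivial).1, fun i => (hx i trivial).2.le⟩

theorem restrict_unitBox : (volume : Measure Dom3).restrict unitBox = volume.restrict (Icc 0 1) :=
  Measure.restrict_congr_set unitBox_ae_eq_Icc

instance isProbabilityMeasure_unitBox :
    IsProbabilityMeasure ((volume : Measure Dom3).restrict unitBox) :=
  ⟨by rw [Measure.restrict_apply_univ, volume_unitBox]⟩

theorem integrableOn_unitBox {H : Type*} [NormedAddCommGroup H] {f : Dom3 → H}
    (hf : Continuous f) : IntegrableOn f unitBox :=
  (hf.continuousOn.integrableOn_compact isCompact_Icc).mono_set unitBox_subset_Icc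

theorem setIntegral_swap_of_continuous {X Y : Type*} [TopologicalSpace X] [T2Space X]
    [MeasurableSpace X] [BorelSpace X] [SecondCountableTopology X]
    [TopologicalSpace Y] [T2Space Y] [MeasurableSpace Y] [BorelSpace Y]
    [SecondCountableTopology Y]
    {μ : Measure X} {ν : Measure Y} [IsFiniteMeasureOnCompacts μ] [IsFiniteMeasureOnCompacts ν]
    [SFinite μ] [SFinite ν] {A : Set X} {B : Set Y} (hA : IsCompact A) (hB : IsCompact B)
    {f : X → Y → ℝ} (hf : Continuous (uncurry f)) :
    ∫ x in A, ∫ y in B, f x y ∂ν ∂μ = ∫ y in B, ∫ x in A, f x y ∂μ ∂ν := by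
  refine integral_integral_swap ?_
  rw [Measure.prod_restrict]
  refine IntegrableOn.of_bound ?_ hf.aestronglyMeasurable
    ((hA.prod hB).exists_bound_of_continuousOn hf.continuousOn).choose ?_
  · rw [Measure.prod_prod]
    exact ENNReal.mul_lt_top hA.measure_lt_top hB.measure_lt_top
  · filter_upwards [ae_restrict_mem (hA.prod hB).measurableSet] with z hz
    exact ((hA.prod hB).exists_bound_of_continuousOn hf.continuousOn).choose_spec z hz

theorem setIntegral_unitBox_pd {h : Dom3 → ℝ} (hh : ContDiff ℝ ∞ h) (hp : PeriodicZ3 h)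
    (i : Fin 3) : ∫ x in unitBox, pd i h x = 0 := by
  have hG : ContDiff ℝ ∞ (uncurry fun (s : Dom3) x => h (x + s)) :=
    hh.comp (contDiff_snd.add contDiff_fst)
  have h1 := hasFDerivAt_setIntegral_of_contDiff hG volume
    (isCompact_Icc (a := (0 : Dom3)) (b := 1)) 0
  simp only [← restrict_unitBox, setIntegral_unitBox_add hp] at h1
  have h2 := h1.unique (hasFDerivAt_const _ _)
  have h3 := congrArg (fun L : Dom3 →L[ℝ] ℝ => L (Pi.single i 1)) h2
  have hc : Continuous fun x => fderiv ℝ h x := (hh.fderiv_right (m := ∞) (by simp)).continuous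
  have h4 : ∀ x : Dom3, fderiv ℝ (fun y => h (x + y)) 0 = fderiv ℝ h x := fun x => by
    rw [fderiv_comp_add_left, add_zero]
  simp only [h4] at h3
  rw [ContinuousLinearMap.integral_apply (integrableOn_unitBox hc)] at h3
  simpa [pd] using h3

end BoxIntegral

section PeriodicLemmas

theorem PeriodicZ3.pd {h : Dom3 → ℝ} (hp : PeriodicZ3 h) (i : Fin 3) : PeriodicZ3 (pd i h) := by
  intro x m
  have : (fun y : Dom3 => h (y + fun i => (m i : ℝ))) = h := funext fun y => hp y m
  conv_rhs => rw [← this]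
  simp only [_root_.pd]
  rw [fderiv_comp_add_right]

theorem PeriodicZ3.dirDeriv {h : Dom3 → ℝ} (hp : PeriodicZ3 h) (z : Dom3) :
    PeriodicZ3 (dirDeriv z h) := fun x m => by
  simp only [_root_.dirDeriv, hp.pd _ x m]

variable {r : Dom3 → ℝ} {φ : Dom3 → M33} (z : Dom3)

theorem PeriodicZ3.comp_shift {X : Type*} {f : Dom3 → X} (hf : PeriodicZ3 f)
    (hr : PeriodicZ3 r) : PeriodicZ3 fun x => f (x + r x • z) := fun x m => by
  dsimp only
  rw [hr x m, add_right_comm, hf]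

theorem PeriodicZ3.coord (hφ : PeriodicZ3 φ) (α β : Fin 3) : PeriodicZ3 fun x => φ x (α, β) :=
  fun x m => by simp only [hφ x m]

theorem setIntegral_unitBox_dirDeriv {h : Dom3 → ℝ} (hh : ContDiff ℝ ∞ h) (hp : PeriodicZ3 h) :
    ∫ x in unitBox, dirDeriv z h x = 0 := by
  simp only [dirDeriv]
  rw [integral_finsetSum _ fun k _ =>
    (integrableOn_unitBox (contDiff_pd hh k).continuous).const_mul _]
  simp [integral_const_mul, setIntegral_unitBox_pd hh hp]

/-- The transport by `x ↦ x + r x • z`, weighted by its Jacobian, preserves the mean. -/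
theorem setIntegral_unitBox_det_mul {σ : Dom3 → ℝ} (hr : ContDiff ℝ ∞ r) (hrp : PeriodicZ3 r)
    (hσ : ContDiff ℝ ∞ σ) (hσp : PeriodicZ3 σ) :
    ∫ x in unitBox, shDet r z x * σ (x + r x • z) = ∫ x in unitBox, σ x := by
  set G : ℝ → Dom3 → ℝ := fun l x => (1 + l * dirDeriv z r x) * σ (x + (l * r x) • z)
  have hZ := contDiff_dirDeriv z hr
  have hG : ContDiff ℝ ∞ (uncurry G) :=
    (contDiff_const.add (contDiff_fst.mul (hZ.comp contDiff_snd))).mul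
      (hσ.comp (contDiff_snd.add ((contDiff_fst.mul (hr.comp contDiff_snd)).smul contDiff_const)))
  have h1 := fun l => hasFDerivAt_setIntegral_of_contDiff hG volume
    (isCompact_Icc (a := (0 : Dom3)) (b := 1)) l
  simp only [← restrict_unitBox] at h1
  have h2 : ∀ l x, fderiv ℝ (fun y => G y x) l =
      ContinuousLinearMap.toSpanSingleton ℝ
        (dirDeriv z (fun y => r y * σ (y + (l * r y) • z)) x) := by
    intro l x
    have hlr : ContDiff ℝ ∞ fun y => l * r y := contDiff_const.mul hr
    have e1 : dirDeriv z (fun y => r y * σ (y + (l * r y) • z)) x =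
        dirDeriv z r x * σ (x + (l * r x) • z) + (1 + l * dirDeriv z r x) *
          (r x * dirDeriv z σ (x + (l * r x) • z)) := by
      have hc : ContDiff ℝ ∞ fun y => σ (y + (l * r y) • z) :=
        hσ.comp (contDiff_shift hlr z)
      simp only [dirDeriv, pd_mul hr hc, pd_comp_shift hlr z hσ, pd_const_mul l hr]
      simp only [Fin.sum_univ_three]
      ring
    have hline : HasDerivAt (fun t : ℝ => x + (t * r x) • z) (r x • z) l := by
      simpa using (((hasDerivAt_id l).mul_const (r x)).smul_const z).const_add x
    have hσ' := (hσ.differentiable (by simp) (x + (l * r x) • z)).hasFDerivAt.comp_hasDerivAt l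
      hline
    have h0 := (((hasDerivAt_id l).mul_const (dirDeriv z r x)).const_add 1).mul hσ'
    have e2 : fderiv ℝ σ (x + (l * r x) • z) (r x • z)
        = r x * dirDeriv z σ (x + (l * r x) • z) := by
      rw [map_smul, clm_apply_eq_sum]; rfl
    have := h0.hasFDerivAt.fderiv
    refine Eq.trans ?_ (this.trans ?_)
    · rfl
    · ext
      simp only [ContinuousLinearMap.toSpanSingleton_apply, e1, e2, smul_eq_mul, one_mul,
        Function.comp, id]
  have h3 : ∀ l, ∫ x in unitBox, fderiv ℝ (fun y => G y x) l = 0 := by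
    intro l
    have hlr : ContDiff ℝ ∞ fun y => l * r y := contDiff_const.mul hr
    have hs : ContDiff ℝ ∞ fun y => r y * σ (y + (l * r y) • z) :=
      hr.mul (hσ.comp (contDiff_shift hlr z))
    have hp : PeriodicZ3 fun y => r y * σ (y + (l * r y) • z) := fun x m => by
      have hlp : PeriodicZ3 fun y => l * r y := fun x m => by simp only [hrp x m]
      have := hσp.comp_shift z hlp x m
      dsimp only at this ⊢
      rw [this, hrp x m]
    simp only [h2]
    have := ContinuousLinearMap.integral_comp_comm
      (ContinuousLinearMap.toSpanSingletonCLE (𝕜 := ℝ) (E := ℝ) : ℝ →L[ℝ] (ℝ →L[ℝ] ℝ))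
      (integrableOn_unitBox (contDiff_dirDeriv z hs).continuous)
    refine this.trans ?_
    rw [setIntegral_unitBox_dirDeriv z hs hp, map_zero]
  simp only [h3] at h1
  have h4 := is_const_of_fderiv_eq_zero (𝕜 := ℝ) (fun l => (h1 l).differentiableAt)
    (fun l => (h1 l).fderiv) 1 0
  simpa [G, shDet] using h4

end PeriodicLemmas

section ShiftOperator

variable {F : Type} [NormedAddCommGroup F] [NormedSpace ℝ F]
  {r : Dom3 → ℝ} {φ : Dom3 → M33}

theorem shiftForm_symm {z p : Fin 3 → ℝ} {Q f f' : Fin 3 → Fin 3 → ℝ} (hf : ∀ i j, f i j = f j i)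
    (hf' : ∀ i j, f' i j = f' j i) (hQ : ∀ i j, Q i j = Q j i) (α β : Fin 3) :
    shiftForm z p Q f f' α β = shiftForm z p Q f f' β α := by
  simp only [shiftForm, shiftCoef, shiftAdj, Fin.sum_univ_three, hf 1 0, hf 2 0, hf 2 1, hf' 1 0,
    hf' 2 0, hf' 2 1, hQ 1 0, hQ 2 0, hQ 2 1]
  fin_cases α <;> fin_cases β <;> simp <;> ring

theorem contDiff_shiftField {ζ : F → Dom3} (hζ : ContDiff ℝ ∞ ζ) (hr : ContDiff ℝ ∞ r)
    (hφ : ContDiff ℝ ∞ φ) (α β : Fin 3) :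
    ContDiff ℝ ∞ (uncurry fun (x : Dom3) (u : F) => shiftField r φ (ζ u) x α β) := by
  have hz : ∀ i, ContDiff ℝ ∞ fun q : Dom3 × F => ζ q.2 i := fun i =>
    (contDiff_pi.mp hζ i).comp contDiff_snd
  have hp : ∀ i, ContDiff ℝ ∞ fun q : Dom3 × F => pd i r q.1 := fun i =>
    (contDiff_pd hr i).comp contDiff_fst
  have hr1 : ContDiff ℝ ∞ fun q : Dom3 × F => r q.1 := hr.comp contDiff_fst
  have hpp : ∀ i j, ContDiff ℝ ∞ fun q : Dom3 × F => pd i (pd j r) q.1 := fun i j =>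
    (contDiff_pd (contDiff_pd hr j) i).comp contDiff_fst
  have hs : ContDiff ℝ ∞ fun q : Dom3 × F => q.1 + r q.1 • ζ q.2 :=
    contDiff_fst.add (hr1.smul (hζ.comp contDiff_snd))
  have hf : ∀ i j, ContDiff ℝ ∞ fun q : Dom3 × F => φ (q.1 + r q.1 • ζ q.2) (i, j) := fun i j =>
    (contDiff_coord hφ i j).comp hs
  have hf' : ∀ k i j, ContDiff ℝ ∞ fun q : Dom3 × F =>
      pd k (fun y => φ y (i, j)) (q.1 + r q.1 • ζ q.2) := fun k i j =>
    (contDiff_pd (contDiff_coord hφ i j) k).comp hs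
  unfold Function.uncurry shiftField shiftForm shiftCoef shiftAdj scaleHess dirDeriv
  fun_prop

/-- Averages of transported fields. -/
def shiftOp [MeasureSpace F] (S : Set F) (w : F → ℝ) (ζ : F → Dom3) (r : Dom3 → ℝ)
    (φ : Dom3 → M33) (x : Dom3) : M33 :=
  WithLp.toLp 2 fun q => ∫ u in S, w u * shiftField r φ (ζ u) x q.1 q.2

theorem PeriodicZ3.shiftField (hr : PeriodicZ3 r) (hφ : PeriodicZ3 φ) (z : Dom3) (α β : Fin 3) :
    PeriodicZ3 fun x => shiftField r φ z x α β := fun x m => by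
  have h1 := fun γ δ => (hφ.coord γ δ).comp_shift z hr x m
  have h2 := fun γ δ => ((hφ.coord γ δ).dirDeriv z).comp_shift z hr x m
  have h3 := fun i => hr.pd i x m
  have h4 := hr x m
  have h5 : scaleHess r (x + fun i => (m i : ℝ)) = scaleHess r x := by
    funext i j
    simp only [scaleHess, (hr.pd j).pd i x m, h3, h4]
  simp only at h1 h2
  simp only [_root_.shiftField, h1, h2, h3, h5]
  simp only [h4]

theorem PeriodicZ3.shiftOp {U : Type} [MeasureSpace U] {S : Set U} {w : U → ℝ} {ζ : U → Dom3}
    (hr : PeriodicZ3 r) (hφ : PeriodicZ3 φ) :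
    PeriodicZ3 (shiftOp S w ζ r φ) := fun x m => by
  have h := fun u (q : Fin 3 × Fin 3) => hr.shiftField hφ (ζ u) q.1 q.2 x m
  dsimp only at h
  simp only [_root_.shiftOp, h]

theorem continuous_pd_shiftField {w : F → ℝ} {ζ : F → Dom3} (hw : ContDiff ℝ ∞ w) (hζ : ContDiff ℝ ∞ ζ)
    (hr : ContDiff ℝ ∞ r) (hφ : ContDiff ℝ ∞ φ) (α β i : Fin 3) (x : Dom3) :
    Continuous fun u => w u * pd i (fun y => shiftField r φ (ζ u) y α β) x := by
  have h := (contDiff_fderiv_param (contDiff_shiftField hζ hr hφ α β)).continuous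
  have h1 : Continuous fun u => fderiv ℝ (fun y => shiftField r φ (ζ u) y α β) x :=
    h.comp (g := uncurry fun x u => fderiv ℝ (fun y => shiftField r φ (ζ u) y α β) x)
      (f := fun u => (x, u)) (by fun_prop)
  exact hw.continuous.mul (h1.clm_apply continuous_const)

variable [MeasureSpace F] [BorelSpace F] [SecondCountableTopology F]
  [IsLocallyFiniteMeasure (volume : Measure F)] {S : Set F} {w : F → ℝ} {ζ : F → Dom3}

theorem contDiff_shiftOp (hS : IsCompact S) (hw : ContDiff ℝ ∞ w) (hζ : ContDiff ℝ ∞ ζ)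
    (hr : ContDiff ℝ ∞ r) (hφ : ContDiff ℝ ∞ φ) : ContDiff ℝ ∞ (shiftOp S w ζ r φ) :=
  contDiff_euclidean.mpr fun q => contDiff_setIntegral_of_contDiff
    (G := fun x u => w u * shiftField r φ (ζ u) x q.1 q.2)
    ((hw.comp contDiff_snd).mul (contDiff_shiftField hζ hr hφ q.1 q.2)) volume hS

theorem pd_shiftOp (hS : IsCompact S) (hw : ContDiff ℝ ∞ w) (hζ : ContDiff ℝ ∞ ζ)
    (hr : ContDiff ℝ ∞ r) (hφ : ContDiff ℝ ∞ φ) (α β i : Fin 3) (x : Dom3) :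
    pd i (fun y => shiftOp S w ζ r φ y (α, β)) x =
      ∫ u in S, w u * pd i (fun y => shiftField r φ (ζ u) y α β) x := by
  have hG : ContDiff ℝ ∞ (uncurry fun x u => w u * shiftField r φ (ζ u) x α β) :=
    (hw.comp contDiff_snd).mul (contDiff_shiftField hζ hr hφ α β)
  have hfd : Continuous fun u => fderiv ℝ (fun y => w u * shiftField r φ (ζ u) y α β) x :=
    (contDiff_fderiv_param hG).continuous.comp
      (g := uncurry fun x u => fderiv ℝ (fun y => w u * shiftField r φ (ζ u) y α β) x)
      (f := fun u => (x, u)) (by fun_prop)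
  change fderiv ℝ (fun y => ∫ u in S, w u * shiftField r φ (ζ u) y α β) x (Pi.single i 1) = _
  rw [(hasFDerivAt_setIntegral_of_contDiff hG volume hS x).fderiv,
    ContinuousLinearMap.integral_apply (hfd.continuousOn.integrableOn_compact hS)]
  refine integral_congr_ae (Eventually.of_forall fun u => ?_)
  exact pd_const_mul (w u)
    ((contDiff_shiftField hζ hr hφ α β).comp (contDiff_id.prodMk contDiff_const)) i x

theorem setIntegral_unitBox_shiftField (z : Dom3) (hr : ContDiff ℝ ∞ r) (hrp : PeriodicZ3 r)
    (hφ : φ ∈ TestClass) (α β : Fin 3) : ∫ x in unitBox, shiftField r φ z x α β = 0 := by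
  obtain ⟨hc, hp, hs, hd, hm⟩ := hφ
  simp only [shiftField_eq_struct z hr hc hd hs, shStruct]
  have hst := fun α β => hp.coord α β
  have hstp : ∀ α β, PeriodicZ3 (shSt r φ z α β) := fun α β => (hst α β).comp_shift z hrp
  have hdp : PeriodicZ3 (shDet r z) := fun x m => by simp only [shDet, hrp.dirDeriv z x m]
  have hfp : ∀ α, PeriodicZ3 (shFlux r φ z α) := fun α x m => by
    simp only [shFlux, (hstp _ _) x m, hrp.pd _ x m]
  have c1 := contDiff_shStruct_aux z hr hc α β
  have p1 : PeriodicZ3 fun y => r y * (shDet r z y * shSt r φ z α β y) := fun x m => by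
    simp only [hstp _ _ x m, hdp x m, hrp x m]
  have c2 : ∀ β, ContDiff ℝ ∞ fun y => r y * shFlux r φ z β y := fun β =>
    hr.mul (contDiff_shFlux z hr hc β)
  have p2 : ∀ β, PeriodicZ3 fun y => r y * shFlux r φ z β y := fun β x m => by
    simp only [hfp _ x m, hrp x m]
  have i0 := integrableOn_unitBox
    ((contDiff_shDet z hr).mul (contDiff_shSt z hr hc α β)).continuous
  have i1 := integrableOn_unitBox (contDiff_dirDeriv z c1).continuous
  have i2 := fun β => integrableOn_unitBox (contDiff_dirDeriv z (c2 β)).continuous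
  have i3 := fun i => integrableOn_unitBox (contDiff_pd (c2 i) i).continuous
  have i4 := integrable_finsetSum Finset.univ fun i _ => i3 i
  have e0 : ∫ x in unitBox, shDet r z x * shSt r φ z α β x = 0 := by
    refine (setIntegral_unitBox_det_mul z hr hrp (contDiff_coord hc α β) (hst α β)).trans ?_
    have := (EuclideanSpace.proj (𝕜 := ℝ) (α, β) : M33 →L[ℝ] ℝ).integral_comp_comm
      (integrableOn_unitBox hc.continuous)
    rw [hm, map_zero] at this
    exact this
  rw [integral_sub, integral_add, integral_add, integral_sub i0 i1, integral_const_mul,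
    integral_const_mul, integral_const_mul, integral_finsetSum _ fun i _ => i3 i, e0,
    setIntegral_unitBox_dirDeriv z c1 p1, setIntegral_unitBox_dirDeriv z (c2 _) (p2 _),
    setIntegral_unitBox_dirDeriv z (c2 _) (p2 _)]
  · simp [setIntegral_unitBox_pd (c2 _) (p2 _)]
  · exact i0.sub i1
  · exact (i2 β).const_mul _
  · exact (i0.sub i1).add ((i2 β).const_mul _)
  · exact (i2 α).const_mul _
  · exact ((i0.sub i1).add ((i2 β).const_mul _)).add ((i2 α).const_mul _)
  · exact i4.const_mul _

theorem shiftOp_mem (hS : IsCompact S) (hw : ContDiff ℝ ∞ w) (hζ : ContDiff ℝ ∞ ζ)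
    (hr : ContDiff ℝ ∞ r) (hrp : PeriodicZ3 r) (hφ : φ ∈ TestClass) :
    shiftOp S w ζ r φ ∈ TestClass := by
  obtain ⟨hc, hp, hs, hd, hm⟩ := hφ
  have hop := contDiff_shiftOp hS hw hζ hr hc
  refine ⟨hop, hrp.shiftOp hp, ?_, ?_, ?_⟩
  · intro x i j
    have hf : ∀ y, ∀ i j, φ y (i, j) = φ y (j, i) := fun y i j => hs y i j
    simp only [shiftOp]
    refine integral_congr_ae (Eventually.of_forall fun u => ?_)
    simp only [shiftField]
    rw [shiftForm_symm (hf _)]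
    · intro i j
      simp only [hf _ i j]
    · intro i j
      simp only [scaleHess, pd_comm hr i j, mul_comm]
  · intro x α
    change ∑ β, pd β (fun y => shiftOp S w ζ r φ y (α, β)) x = 0
    simp only [pd_shiftOp hS hw hζ hr hc]
    rw [← integral_finsetSum _ fun β _ => (continuous_pd_shiftField hw hζ hr hc α β β
      x).continuousOn.integrableOn_compact hS]
    have h : ∀ u, ∑ β, w u * pd β (fun y => shiftField r φ (ζ u) y α β) x = 0 := fun u => by
      simp only [shiftField_eq_struct (ζ u) hr hc hd hs]
      rw [← Finset.mul_sum]
      exact mul_eq_zero_of_right _ (sum_pd_shStruct (ζ u) hr hc hd α x)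
    simp only [h, integral_zero]
  · ext q
    have h := (EuclideanSpace.proj (𝕜 := ℝ) q : M33 →L[ℝ] ℝ).integral_comp_comm
      (integrableOn_unitBox hop.continuous)
    refine h.symm.trans ?_
    change ∫ x in unitBox, ∫ u in S, w u * shiftField r φ (ζ u) x q.1 q.2 = 0
    have hG : ContDiff ℝ ∞ (uncurry fun x u => w u * shiftField r φ (ζ u) x q.1 q.2) :=
      (hw.comp contDiff_snd).mul (contDiff_shiftField hζ hr hc q.1 q.2)
    rw [restrict_unitBox, setIntegral_swap_of_continuous isCompact_Icc hS hG.continuous]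
    simp only [← restrict_unitBox, integral_const_mul]
    simp only [setIntegral_unitBox_shiftField _ hr hrp ⟨hc, hp, hs, hd, hm⟩, mul_zero,
      integral_zero]

end ShiftOperator

section TestClassAlgebra

variable {φ ψ : Dom3 → M33}

theorem TestClass.zero_mem : (fun _ => 0 : Dom3 → M33) ∈ TestClass :=
  ⟨contDiff_const, fun _ _ => rfl, fun _ _ _ => rfl, fun x α => by simp, by simp⟩

theorem TestClass.add_mem (hφ : φ ∈ TestClass) (hψ : ψ ∈ TestClass) :
    (fun x => φ x + ψ x) ∈ TestClass := by
  obtain ⟨hc, hp, hs, hd, hm⟩ := hφ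
  obtain ⟨hc', hp', hs', hd', hm'⟩ := hψ
  refine ⟨hc.add hc', fun x m => by simp only [hp x m, hp' x m], fun x i j => ?_, fun x α => ?_, ?_⟩
  · simp only [PiLp.add_apply, hs x i j, hs' x i j]
  · have h := fun β => pd_add (contDiff_coord hc α β) (contDiff_coord hc' α β) β x
    change ∑ β, pd β (fun y => φ y (α, β) + ψ y (α, β)) x = 0
    simp only [h, Finset.sum_add_distrib, hd.sum_pd, hd'.sum_pd, add_zero]
  · rw [integral_add (integrableOn_unitBox hc.continuous) (integrableOn_unitBox hc'.continuous),
      hm, hm', add_zero]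

theorem TestClass.neg_mem (hφ : φ ∈ TestClass) : (fun x => -φ x) ∈ TestClass := by
  obtain ⟨hc, hp, hs, hd, hm⟩ := hφ
  refine ⟨hc.neg, fun x m => by simp only [hp x m], fun x i j => ?_, fun x α => ?_, ?_⟩
  · simp only [PiLp.neg_apply, hs x i j]
  · have h := fun β => pd_const_mul (-1) (contDiff_coord hc α β) β x
    change ∑ β, pd β (fun y => -φ y (α, β)) x = 0
    simp only [neg_one_mul] at h
    simp only [h, Finset.sum_neg_distrib, hd.sum_pd, neg_zero]
  · rw [integral_neg, hm, neg_zero]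

theorem TestClass.sub_mem (hφ : φ ∈ TestClass) (hψ : ψ ∈ TestClass) :
    (fun x => φ x - ψ x) ∈ TestClass := by
  simpa only [sub_eq_add_neg] using TestClass.add_mem hφ (TestClass.neg_mem hψ)

theorem TestClass.sum_mem {ι : Type*} (s : Finset ι) {φ : ι → Dom3 → M33}
    (hφ : ∀ j, φ j ∈ TestClass) : (fun x => ∑ j ∈ s, φ j x) ∈ TestClass := by
  classical
  induction s using Finset.induction_on with
  | empty => simpa using TestClass.zero_mem
  | insert j s hj ih => simpa only [Finset.sum_insert hj] using TestClass.add_mem (hφ j) ih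

theorem PeriodicZ3.comp_scale {X : Type*} {f : Dom3 → X} (hf : PeriodicZ3 f) (k : ℕ) (t : Dom3) :
    PeriodicZ3 fun x => f ((k : ℝ) • x + t) := fun x m => by
  have := hf ((k : ℝ) • x + t) fun i => k * m i
  dsimp only
  rw [← this]
  congr 1
  ext i
  simp
  ring

/-- The average over translates does not depend on the oscillation scale. -/
theorem setIntegral_unitBox_oscillation {G : Dom3 → Dom3 → ℝ} (hG : Continuous (uncurry G))
    (hp : ∀ x, PeriodicZ3 (G x)) (k : ℝ) :
    ∫ t in unitBox, ∫ x in unitBox, G x (k • x + t) = ∫ x in unitBox, ∫ t in unitBox, G x t := by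
  have hc : Continuous (uncurry fun t x : Dom3 => G x (k • x + t)) :=
    hG.comp (f := fun q : Dom3 × Dom3 => (q.2, k • q.2 + q.1)) (by fun_prop)
  rw [restrict_unitBox, setIntegral_swap_of_continuous isCompact_Icc isCompact_Icc hc,
    ← restrict_unitBox]
  refine integral_congr_ae (Eventually.of_forall fun x => ?_)
  have := setIntegral_unitBox_add (hp x) (k • x)
  simp only [add_comm (k • x)]
  exact this

theorem setIntegral_unitBox_scale {f : Dom3 → ℝ} (hf : Continuous f) (hp : PeriodicZ3 f)
    {k : ℕ} (hk : k ≠ 0) (t : Dom3) :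
    ∫ x in unitBox, f ((k : ℝ) • x + t) = ∫ x in unitBox, f x := by
  have h := setIntegral_unitBox_oscillation (G := fun _ => f) (hf.comp continuous_snd)
    (fun _ => hp) k
  have hk' : (k : ℝ) ≠ 0 := Nat.cast_ne_zero.mpr hk
  have h1 : ∀ t, ∫ x in unitBox, f ((k : ℝ) • x + t) = ∫ x in unitBox, f ((k : ℝ) • x) := by
    intro t
    have h2 := hp.comp_scale k 0
    simp only [add_zero] at h2
    have := setIntegral_unitBox_add h2 ((k : ℝ)⁻¹ • t)
    simpa only [smul_add, smul_inv_smul₀ hk'] using this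
  simp only [h1] at h
  rw [h1]
  simpa using h

theorem pd_comp_scale {f : Dom3 → ℝ} (hf : ContDiff ℝ ∞ f) (k : ℝ) (t : Dom3) (i : Fin 3)
    (x : Dom3) : pd i (fun y => f (k • y + t)) x = k * pd i f (k • x + t) := by
  have h1 : HasFDerivAt (fun x : Dom3 => k • x + t) (k • ContinuousLinearMap.id ℝ Dom3) x :=
    ((hasFDerivAt_id x).const_smul k).add_const t
  have h2 := (hf.differentiable (by simp) (k • x + t)).hasFDerivAt
  have h3 := (h2.comp x h1).fderiv
  simp only [Function.comp_def] at h3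
  simp only [pd]
  rw [h3]
  simp

theorem TestClass.comp_scale (hφ : φ ∈ TestClass) {k : ℕ} (hk : k ≠ 0) (t : Dom3) :
    (fun x => φ ((k : ℝ) • x + t)) ∈ TestClass := by
  obtain ⟨hc, hp, hs, hd, hm⟩ := hφ
  have hsc : ContDiff ℝ ∞ fun x : Dom3 => (k : ℝ) • x + t :=
    (contDiff_id.const_smul (k : ℝ)).add contDiff_const
  refine ⟨hc.comp hsc, hp.comp_scale k t, fun x => hs _, fun x α => ?_, ?_⟩
  · have h := fun β => pd_comp_scale (contDiff_coord hc α β) k t β x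
    change ∑ β, pd β (fun y => φ ((k : ℝ) • y + t) (α, β)) x = 0
    simp only [h, ← Finset.mul_sum, hd.sum_pd, mul_zero]
  · ext q
    have e1 := (EuclideanSpace.proj (𝕜 := ℝ) q : M33 →L[ℝ] ℝ).integral_comp_comm
      (integrableOn_unitBox hc.continuous)
    have e2 := (EuclideanSpace.proj (𝕜 := ℝ) q : M33 →L[ℝ] ℝ).integral_comp_comm
      (integrableOn_unitBox (hc.comp hsc).continuous)
    refine e2.symm.trans ?_
    have e3 := setIntegral_unitBox_scale (contDiff_coord hc q.1 q.2).continuous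
      (hp.coord q.1 q.2) hk t
    refine e3.trans (e1.trans ?_)
    rw [hm]
    rfl

theorem PeriodicZ3.bounded {f : Dom3 → ℝ} (hf : Continuous f) (hp : PeriodicZ3 f) :
    ∃ C, ∀ x, |f x| ≤ C := by
  obtain ⟨C, hC⟩ := isCompact_Icc.exists_bound_of_continuousOn (s := Icc (0 : Dom3) 1)
    hf.continuousOn
  refine ⟨C, fun x => ?_⟩
  have := hp x fun i => -⌊x i⌋
  rw [← this]
  refine hC _ ⟨fun i => ?_, fun i => ?_⟩
  · simp [Int.floor_le]
  · simpa [add_comm] using (Int.lt_floor_add_one (x i)).le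

end TestClassAlgebra

section Envelope

theorem sdqcEnvelope_le {f : M33 → ℝ} (hf : ∀ a, 0 ≤ f a) (ξ : M33) {φ : Dom3 → M33}
    (hφ : φ ∈ TestClass) : sdqcEnvelope f ξ ≤ ∫ x in unitBox, f (ξ + φ x) :=
  csInf_le ⟨0, by rintro _ ⟨φ, -, rfl⟩; exact integral_nonneg fun x => hf _⟩ ⟨φ, hφ, rfl⟩

theorem sdqcEnvelope_nonneg {f : M33 → ℝ} (hf : ∀ a, 0 ≤ f a) (ξ : M33) : 0 ≤ sdqcEnvelope f ξ :=
  Real.sInf_nonneg (by rintro _ ⟨φ, -, rfl⟩; exact integral_nonneg fun x => hf _)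

theorem exists_lt_of_sdqcEnvelope_lt {f : M33 → ℝ} {ξ : M33} {c : ℝ} (h : sdqcEnvelope f ξ < c) :
    ∃ φ ∈ TestClass, ∫ x in unitBox, f (ξ + φ x) < c := by
  obtain ⟨_, ⟨φ, hφ, rfl⟩, h'⟩ := exists_lt_of_csInf_lt (Set.Nonempty.image _ ⟨_, TestClass.zero_mem⟩) h
  exact ⟨φ, hφ, h'⟩

theorem sdqcEnvelope_le_self {f : M33 → ℝ} (hf : ∀ a, 0 ≤ f a) (ξ : M33) :
    sdqcEnvelope f ξ ≤ f ξ := by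
  simpa using sdqcEnvelope_le hf ξ TestClass.zero_mem

theorem continuous_sdqcEnvelope {f : M33 → ℝ} (hf : ∀ a, 0 ≤ f a) (hc : Continuous f)
    (hf' : ∀ κ > 0, ∃ δ > 0, ∀ a h : M33, ‖h‖ < δ → f (a + h) ≤ (1 + κ) * f a + κ) :
    Continuous (sdqcEnvelope f) := by
  have key : ∀ κ > 0, ∃ δ > 0, ∀ a h : M33, ‖h‖ < δ →
      sdqcEnvelope f (a + h) ≤ (1 + κ) * sdqcEnvelope f a + κ := by
    intro κ hκ
    obtain ⟨δ, hδ, h⟩ := hf' κ hκ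
    refine ⟨δ, hδ, fun a t ht => ?_⟩
    refine le_of_forall_pos_le_add fun ε hε => ?_
    have : sdqcEnvelope f a < sdqcEnvelope f a + ε / (1 + κ) := by
      have : 0 < ε / (1 + κ) := by positivity
      linarith
    obtain ⟨φ, hφ, hlt⟩ := exists_lt_of_sdqcEnvelope_lt this
    have hi : ∀ b, Integrable (fun x => f (b + φ x)) (volume.restrict unitBox) := fun b =>
      integrableOn_unitBox (hc.comp (continuous_const.add hφ.1.continuous))
    calc sdqcEnvelope f (a + t) ≤ ∫ x in unitBox, f (a + t + φ x) := sdqcEnvelope_le hf _ hφ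
      _ ≤ ∫ x in unitBox, ((1 + κ) * f (a + φ x) + κ) := by
        refine integral_mono (hi _) (((hi a).const_mul _).add (integrable_const _)) fun x => ?_
        have := h (a + φ x) t ht
        rwa [add_right_comm] at this
      _ = (1 + κ) * (∫ x in unitBox, f (a + φ x)) + κ := by
        rw [integral_add ((hi a).const_mul _) (integrable_const _), integral_const_mul]
        simp
      _ ≤ (1 + κ) * (sdqcEnvelope f a + ε / (1 + κ)) + κ := by gcongr
      _ = (1 + κ) * sdqcEnvelope f a + κ + ε := by field_simp; ring
  rw [Metric.continuous_iff]
  intro a ε hε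
  have h0 := sdqcEnvelope_nonneg hf
  set q := sdqcEnvelope f a with hq
  have hq0 : 0 ≤ q := h0 a
  set κ : ℝ := min 1 (ε / (4 * (q + 1)))
  have hκ : 0 < κ := by positivity
  have hκ1 : κ ≤ 1 := min_le_left _ _
  have hκ2 : κ * (q + 1) * 4 ≤ ε := by
    have : κ ≤ ε / (4 * (q + 1)) := min_le_right _ _
    rw [le_div_iff₀ (by positivity)] at this
    linarith
  obtain ⟨δ, hδ, h⟩ := key κ hκ
  refine ⟨δ, hδ, fun b hb => ?_⟩
  rw [dist_eq_norm] at hb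
  have h1 := h a (b - a) hb
  have h2 := h b (a - b) (by rwa [norm_sub_rev])
  rw [add_sub_cancel] at h1 h2
  rw [Real.dist_eq, abs_lt]
  have hb0 := h0 b
  constructor <;> nlinarith

end Envelope

section Localization

/-- The product of two unit cubes. -/
def boxPair : Set (Dom3 × Dom3) := Icc 0 1 ×ˢ Icc 0 1

theorem isCompact_boxPair : IsCompact boxPair := isCompact_Icc.prod isCompact_Icc

theorem volume_real_boxPair : volume.real boxPair = 1 := by
  rw [measureReal_def, boxPair, Measure.volume_eq_prod, Measure.prod_prod]
  have : volume (Icc (0 : Dom3) 1) = 1 := by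
    rw [← measure_congr unitBox_ae_eq_Icc, volume_unitBox]
  simp [this]

/-- The transported field at oscillation scale `κ`, as a function of the slow variable `x` and
the fast variable `X`. -/
def twoScaleShift (η : Dom3 → ℝ) (φ : Dom3 → M33) (κ : ℝ) (x X : Dom3) : M33 :=
  WithLp.toLp 2 fun q => ∫ u in boxPair, shiftForm (u.1 + u.2) (fun i => κ * pd i η x)
    (fun i j => κ ^ 2 * scaleHess η x i j) (fun γ δ => φ (X + η x • (u.1 + u.2)) (γ, δ))
    (fun γ δ => η x * dirDeriv (u.1 + u.2) (fun y => φ y (γ, δ)) (X + η x • (u.1 + u.2))) q.1 q.2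

/-- The transported field for a constant scale `ρ`. -/
def fixedShift (φ : Dom3 → M33) (ρ : ℝ) (X : Dom3) : M33 :=
  WithLp.toLp 2 fun q => ∫ u in boxPair, (φ (X + ρ • (u.1 + u.2)) q
    - ρ * dirDeriv (u.1 + u.2) (fun y => φ y q) (X + ρ • (u.1 + u.2)))

variable {η : Dom3 → ℝ} {φ : Dom3 → M33}

theorem continuous_twoScaleShift (hη : ContDiff ℝ ∞ η) (hφ : ContDiff ℝ ∞ φ) :
    Continuous fun q : ℝ × Dom3 × Dom3 => twoScaleShift η φ q.1 q.2.1 q.2.2 := by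
  refine (contDiff_euclidean (n := ∞).mpr fun i => ?_).continuous
  have hz : ∀ i, ContDiff ℝ ∞ fun q : (ℝ × Dom3 × Dom3) × Dom3 × Dom3 => (q.2.1 + q.2.2) i :=
    fun i => (contDiff_apply ℝ ℝ i).comp (by fun_prop)
  have hx : ContDiff ℝ ∞ fun q : (ℝ × Dom3 × Dom3) × Dom3 × Dom3 => q.1.2.1 := by fun_prop
  have hη1 := hη.comp hx
  have hp : ∀ i, ContDiff ℝ ∞ fun q : (ℝ × Dom3 × Dom3) × Dom3 × Dom3 => pd i η q.1.2.1 :=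
    fun i => (contDiff_pd hη i).comp hx
  have hpp : ∀ i j, ContDiff ℝ ∞ fun q : (ℝ × Dom3 × Dom3) × Dom3 × Dom3 =>
      pd i (pd j η) q.1.2.1 := fun i j => (contDiff_pd (contDiff_pd hη j) i).comp hx
  have hs : ContDiff ℝ ∞ fun q : (ℝ × Dom3 × Dom3) × Dom3 × Dom3 =>
      q.1.2.2 + η q.1.2.1 • (q.2.1 + q.2.2) :=
    ContDiff.add (by fun_prop) (hη1.smul (by fun_prop))
  have hf : ∀ i j, ContDiff ℝ ∞ fun q : (ℝ × Dom3 × Dom3) × Dom3 × Dom3 =>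
      φ (q.1.2.2 + η q.1.2.1 • (q.2.1 + q.2.2)) (i, j) := fun i j =>
    (contDiff_coord hφ i j).comp hs
  have hf' : ∀ k i j, ContDiff ℝ ∞ fun q : (ℝ × Dom3 × Dom3) × Dom3 × Dom3 =>
      pd k (fun y => φ y (i, j)) (q.1.2.2 + η q.1.2.1 • (q.2.1 + q.2.2)) := fun k i j =>
    (contDiff_pd (contDiff_coord hφ i j) k).comp hs
  simp only [Function.comp_def] at hη1
  refine contDiff_setIntegral_of_contDiff (G := fun (q : ℝ × Dom3 × Dom3) (u : Dom3 × Dom3) =>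
    shiftForm (u.1 + u.2) (fun i => q.1 * pd i η q.2.1)
    (fun i j => q.1 ^ 2 * scaleHess η q.2.1 i j)
    (fun γ δ => φ (q.2.2 + η q.2.1 • (u.1 + u.2)) (γ, δ))
    (fun γ δ => η q.2.1 * dirDeriv (u.1 + u.2) (fun y => φ y (γ, δ))
      (q.2.2 + η q.2.1 • (u.1 + u.2))) i.1 i.2) ?_ volume isCompact_boxPair
  unfold Function.uncurry shiftForm shiftCoef shiftAdj scaleHess dirDeriv
  fun_prop

theorem continuous_fixedShift (hφ : ContDiff ℝ ∞ φ) :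
    Continuous fun q : ℝ × Dom3 => fixedShift φ q.1 q.2 := by
  refine (contDiff_euclidean (n := ∞).mpr fun i => ?_).continuous
  have hz : ∀ i, ContDiff ℝ ∞ fun q : (ℝ × Dom3) × Dom3 × Dom3 => (q.2.1 + q.2.2) i :=
    fun i => (contDiff_apply ℝ ℝ i).comp (by fun_prop)
  have hs : ContDiff ℝ ∞ fun q : (ℝ × Dom3) × Dom3 × Dom3 =>
      q.1.2 + q.1.1 • (q.2.1 + q.2.2) := by fun_prop
  have hf : ContDiff ℝ ∞ fun q : (ℝ × Dom3) × Dom3 × Dom3 =>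
      φ (q.1.2 + q.1.1 • (q.2.1 + q.2.2)) i := (contDiff_coord hφ i.1 i.2).comp hs
  have hf' : ∀ k, ContDiff ℝ ∞ fun q : (ℝ × Dom3) × Dom3 × Dom3 =>
      pd k (fun y => φ y i) (q.1.2 + q.1.1 • (q.2.1 + q.2.2)) := fun k =>
    (contDiff_pd (contDiff_coord hφ i.1 i.2) k).comp hs
  refine contDiff_setIntegral_of_contDiff (G := fun (q : ℝ × Dom3) (u : Dom3 × Dom3) =>
    φ (q.2 + q.1 • (u.1 + u.2)) i
      - q.1 * dirDeriv (u.1 + u.2) (fun y => φ y i) (q.2 + q.1 • (u.1 + u.2))) ?_ volume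
      isCompact_boxPair
  unfold Function.uncurry dirDeriv
  fun_prop

theorem shiftForm_zero (z : Fin 3 → ℝ) (f f' : Fin 3 → Fin 3 → ℝ) (α β : Fin 3) :
    shiftForm z (fun _ => 0) (fun _ _ => 0) f f' α β = f α β - f' α β := by
  simp [shiftForm, shiftCoef, shiftAdj]

theorem twoScaleShift_zero (x X : Dom3) : twoScaleShift η φ 0 x X = fixedShift φ (η x) X := by
  simp [twoScaleShift, fixedShift, shiftForm_zero]

theorem shiftOp_oscillation (hη : ContDiff ℝ ∞ η) (hφ : ContDiff ℝ ∞ φ) {k : ℝ} (hk : k ≠ 0)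
    (t x : Dom3) :
    shiftOp boxPair (fun _ => 1) (fun u => u.1 + u.2) (fun y => k⁻¹ * η y)
      (fun y => φ (k • y + t)) x = twoScaleShift η φ k⁻¹ x (k • x + t) := by
  have h1 : ∀ i x, pd i (fun y => k⁻¹ * η y) x = k⁻¹ * pd i η x := fun i => pd_const_mul _ hη i
  have h2 : scaleHess (fun y => k⁻¹ * η y) x = fun i j => k⁻¹ ^ 2 * scaleHess η x i j := by
    funext i j
    have e : pd j (fun y => k⁻¹ * η y) = fun y => k⁻¹ * pd j η y := funext (h1 j)
    simp only [scaleHess, e, h1, pd_const_mul _ (contDiff_pd hη j)]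
    ring
  have h3 : ∀ z : Dom3, k • (x + (k⁻¹ * η x) • z) + t = k • x + t + η x • z := fun z => by
    rw [smul_add, smul_smul, mul_inv_cancel_left₀ hk, add_right_comm]
  have h4 : ∀ γ δ (z y : Dom3), dirDeriv z (fun y => φ (k • y + t) (γ, δ)) y =
      k * dirDeriv z (fun y => φ y (γ, δ)) (k • y + t) := fun γ δ z y => by
    simp only [dirDeriv, pd_comp_scale (contDiff_coord hφ γ δ), Finset.mul_sum]
    exact Finset.sum_congr rfl fun _ _ => by ring
  simp only [shiftOp, twoScaleShift, shiftField, h1, h2, h4, h3, one_mul]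
  have h5 : ∀ a, k⁻¹ * η x * (k * a) = η x * a := fun a => by field_simp
  simp only [h5]

theorem fixedShift_zero (X : Dom3) : fixedShift φ 0 X = φ X := by
  ext q
  simp [fixedShift, volume_real_boxPair]

theorem fixedShift_one (hφ : φ ∈ TestClass) (X : Dom3) : fixedShift φ 1 X = 0 := by
  obtain ⟨hc, hp, hs, hd, hm⟩ := hφ
  ext q
  have hcq := contDiff_coord hc q.1 q.2
  have hpq := hp.coord q.1 q.2
  have hm0 : ∫ x in unitBox, φ x q = 0 := by
    have := (EuclideanSpace.proj (𝕜 := ℝ) q : M33 →L[ℝ] ℝ).integral_comp_comm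
      (integrableOn_unitBox hc.continuous)
    rw [hm, map_zero] at this
    exact this
  have hshift : ∀ {f : Dom3 → ℝ}, PeriodicZ3 f → ∀ a, ∫ b in unitBox, f (X + (a + b))
      = ∫ b in unitBox, f b := fun hf a => by
    rw [← setIntegral_unitBox_add hf (X + a)]
    simp only [add_comm, add_left_comm]
  have hpair : ∀ {G : Dom3 → Dom3 → ℝ}, Continuous (uncurry G) →
      ∫ u in boxPair, G u.1 u.2 = ∫ a in unitBox, ∫ b in unitBox, G a b := fun {G} hG => by
    rw [restrict_unitBox]
    exact setIntegral_prod (uncurry G) (hG.continuousOn.integrableOn_compact isCompact_boxPair)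
  have hI : ∀ {f : Dom3 × Dom3 → ℝ}, Continuous f → IntegrableOn f boxPair := fun hf =>
    hf.continuousOn.integrableOn_compact isCompact_boxPair
  have e0 : ∫ u in boxPair, φ (X + (u.1 + u.2)) q = 0 := by
    rw [hpair (G := fun a b => φ (X + (a + b)) q)
      (hcq.continuous.comp (f := fun u : Dom3 × Dom3 => X + (u.1 + u.2)) (by fun_prop))]
    have := fun a => hshift hpq a
    dsimp only at this
    simp only [this]
    simp [hm0]
  have hk0 := fun k => setIntegral_unitBox_pd hcq hpq k
  have hkp := fun k => hpq.pd k
  have hkc := fun k => (contDiff_pd hcq k).continuous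
  have c1 : ∀ k, Continuous fun u : Dom3 × Dom3 => u.1 k * pd k (fun y => φ y q) (X + (u.1 + u.2)) :=
    fun k => Continuous.mul (by fun_prop) ((hkc k).comp (by fun_prop))
  have c2 : ∀ k, Continuous fun u : Dom3 × Dom3 => u.2 k * pd k (fun y => φ y q) (X + (u.1 + u.2)) :=
    fun k => Continuous.mul (by fun_prop) ((hkc k).comp (by fun_prop))
  have e1 : ∀ k, ∫ u in boxPair, u.1 k * pd k (fun y => φ y q) (X + (u.1 + u.2)) = 0 := fun k => by
    rw [hpair (G := fun a b => a k * pd k (fun y => φ y q) (X + (a + b))) (c1 k)]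
    simp only [integral_const_mul]
    have := fun a => hshift (hkp k) a
    simp only [this]
    simp [hk0]
  have e2 : ∀ k, ∫ u in boxPair, u.2 k * pd k (fun y => φ y q) (X + (u.1 + u.2)) = 0 := fun k => by
    rw [hpair (G := fun a b => b k * pd k (fun y => φ y q) (X + (a + b))) (c2 k)]
    rw [restrict_unitBox, setIntegral_swap_of_continuous isCompact_Icc isCompact_Icc (c2 k),
      ← restrict_unitBox]
    simp only [integral_const_mul]
    have := fun a => hshift (hkp k) a
    simp only [add_comm] at this ⊢
    simp only [this]
    simp [hk0]
  simp only [fixedShift, one_smul, one_mul, dirDeriv, Pi.add_apply, add_mul,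
    Finset.sum_add_distrib, PiLp.zero_apply]
  rw [integral_sub, integral_add, integral_finsetSum, integral_finsetSum, e0]
  · simp [e1, e2]
  · exact fun k _ => hI (c2 k)
  · exact fun k _ => hI (c1 k)
  · exact integrable_finsetSum _ fun k _ => hI (c1 k)
  · exact integrable_finsetSum _ fun k _ => hI (c2 k)
  · exact hI (hcq.continuous.comp (by fun_prop))
  · exact (integrable_finsetSum _ fun k _ => hI (c1 k)).add
      (integrable_finsetSum _ fun k _ => hI (c2 k))

end Localization

section Mollification

theorem exists_smooth_periodic_tendsto_indicator {A : Set Dom3} (hA : MeasurableSet A)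
    (hp : PeriodicZ3 (A.indicator fun _ => (1 : ℝ))) :
    ∃ η : ℕ → Dom3 → ℝ, (∀ n, ContDiff ℝ ∞ (η n)) ∧ (∀ n, PeriodicZ3 (η n)) ∧
      (∀ n x, η n x ∈ Icc (0 : ℝ) 1) ∧
      ∀ᵐ x, Tendsto (fun n => η n x) atTop (𝓝 (A.indicator (fun _ => 1) x)) := by
  set g : Dom3 → ℝ := A.indicator fun _ => 1
  have hg : LocallyIntegrable g := (locallyIntegrable_const (1 : ℝ)).indicator hA
  have hg01 : ∀ x, g x ∈ Icc (0 : ℝ) 1 := fun x => by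
    by_cases hx : x ∈ A <;> simp [g, hx]
  let b : ℕ → ContDiffBump (0 : Dom3) := fun n =>
    ⟨1 / ((n : ℝ) + 1) / 2, 1 / ((n : ℝ) + 1), by positivity, half_lt_self (by positivity)⟩
  refine ⟨fun n => convolution ((b n).normed volume) g (ContinuousLinearMap.lsmul ℝ ℝ) volume,
    fun n => ?_, fun n x m => ?_, fun n x => ?_, ?_⟩
  · exact (b n).hasCompactSupport_normed.contDiff_convolution_left _ (b n).contDiff_normed hg
  · simp only [convolution_def]
    refine integral_congr_ae (Eventually.of_forall fun t => ?_)
    have := hp (x - t) m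
    rw [sub_add_eq_add_sub] at this
    simp only [this, g]
  · have hi : Integrable ((b n).normed volume) := (b n).integrable_normed
    have hi2 : Integrable fun t => (b n).normed volume t • g (x - t) := by
      refine hi.mono ?_ (Eventually.of_forall fun t => ?_)
      · refine (b n).continuous_normed.aestronglyMeasurable.smul ?_
        exact (Measurable.comp (g := g) (measurable_const.indicator hA)
          (measurable_const.sub measurable_id)).aestronglyMeasurable
      · rw [norm_smul]
        refine mul_le_of_le_one_right (norm_nonneg _) ?_
        rw [Real.norm_of_nonneg (hg01 _).1]
        exact (hg01 _).2
    simp only [convolution_def, ContinuousLinearMap.lsmul_apply]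
    refine ⟨integral_nonneg fun t => mul_nonneg ((b n).nonneg_normed t) (hg01 _).1, ?_⟩
    refine (integral_mono hi2 hi fun t => ?_).trans_eq (b n).integral_normed
    exact mul_le_of_le_one_right ((b n).nonneg_normed t) (hg01 _).2
  · refine ContDiffBump.ae_convolution_tendsto_right_of_locallyIntegrable (K := 2)
      tendsto_one_div_add_atTop_nhds_zero_nat (Eventually.of_forall fun n => ?_) hg
    simp only [b]
    linarith

end Mollification

section Quasiconvexity

theorem sdqcEnvelope_le_fixedShift {f : M33 → ℝ} (hf : ∀ a, 0 ≤ f a) (hfc : Continuous f)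
    (ξ : M33) {φ : Dom3 → M33} (hφ : φ ∈ TestClass) {ι : Type*} [Fintype ι]
    {ψ : ι → Dom3 → M33} (hψ : ∀ j, ψ j ∈ TestClass) {η : ι → Dom3 → ℝ}
    (hη : ∀ j, ContDiff ℝ ∞ (η j)) (hηp : ∀ j, PeriodicZ3 (η j)) :
    sdqcEnvelope f ξ ≤ ∫ x in unitBox, ∫ t in unitBox,
      f (ξ + (φ x + ∑ j, (ψ j t - fixedShift (ψ j) (η j x) t))) := by
  set g : ℝ → Dom3 → Dom3 → ℝ := fun κ x X =>
    f (ξ + (φ x + ∑ j, (ψ j X - twoScaleShift (η j) (ψ j) κ x X))) with hg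
  have hgc : Continuous fun q : ℝ × Dom3 × Dom3 => g q.1 q.2.1 q.2.2 := by
    have h1 := fun j => continuous_twoScaleShift (hη j) (hψ j).1
    have h2 := fun j => (hψ j).1.continuous
    have h3 := hφ.1.continuous
    simp only [hg]
    fun_prop
  have hgp : ∀ κ x, PeriodicZ3 (g κ x) := fun κ x X m => by
    have e : ∀ j, twoScaleShift (η j) (ψ j) κ x (X + fun i => (m i : ℝ)) =
        twoScaleShift (η j) (ψ j) κ x X := fun j => by
      have h1 : ∀ v : Dom3, ψ j ((X + fun i => (m i : ℝ)) + v) = ψ j (X + v) := fun v => by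
        rw [add_right_comm, (hψ j).2.1]
      have h2 : ∀ v w : Dom3, ∀ γ δ, dirDeriv v (fun y => ψ j y (γ, δ))
          ((X + fun i => (m i : ℝ)) + w) = dirDeriv v (fun y => ψ j y (γ, δ)) (X + w) :=
        fun v w γ δ => by rw [add_right_comm, ((hψ j).2.1.coord γ δ).dirDeriv v]
      simp only [twoScaleShift, h1, h2]
    simp only [hg, e, (hψ _).2.1 X m]
  have hgκ : ∀ κ, Continuous (uncurry (g κ)) := fun κ =>
    hgc.comp (f := fun q : Dom3 × Dom3 => (κ, q)) (by fun_prop)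
  have hstep : ∀ n : ℕ, sdqcEnvelope f ξ ≤
      ∫ x in unitBox, ∫ t in unitBox, g (1 / ((n : ℝ) + 1)) x t := by
    intro n
    have hk : ((n + 1 : ℕ) : ℝ) ≠ 0 := Nat.cast_ne_zero.mpr n.succ_ne_zero
    have hmem : ∀ t, (fun x => φ x + ∑ j, (ψ j (((n + 1 : ℕ) : ℝ) • x + t)
        - twoScaleShift (η j) (ψ j) ((n + 1 : ℕ) : ℝ)⁻¹ x (((n + 1 : ℕ) : ℝ) • x + t)))
        ∈ TestClass := by
      intro t
      refine TestClass.add_mem hφ (TestClass.sum_mem _ fun j => ?_)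
      have h1 := TestClass.comp_scale (hψ j) n.succ_ne_zero t
      simp only [← shiftOp_oscillation (hη j) (hψ j).1 hk]
      refine TestClass.sub_mem h1 (shiftOp_mem isCompact_boxPair contDiff_const
        (contDiff_fst.add contDiff_snd) (contDiff_const.mul (hη j)) (fun x m => ?_) h1)
      rw [hηp j x m]
    have h1 : ∀ t, sdqcEnvelope f ξ ≤
        ∫ x in unitBox, g (1 / ((n : ℝ) + 1)) x (((n + 1 : ℕ) : ℝ) • x + t) := fun t => by
      simpa [hg] using sdqcEnvelope_le hf ξ (hmem t)
    rw [← setIntegral_unitBox_oscillation (hgκ _) (hgp _) ((n + 1 : ℕ) : ℝ)]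
    have hc : Continuous fun t => ∫ x in unitBox,
        g (1 / ((n : ℝ) + 1)) x (((n + 1 : ℕ) : ℝ) • x + t) := by
      rw [restrict_unitBox]
      refine continuous_parametric_integral_of_continuous (f := fun t x : Dom3 =>
        g (1 / ((n : ℝ) + 1)) x (((n + 1 : ℕ) : ℝ) • x + t)) ?_ isCompact_Icc
      exact (hgκ _).comp (f := fun q : Dom3 × Dom3 => (q.2, ((n + 1 : ℕ) : ℝ) • q.2 + q.1))
        (by fun_prop)
    simpa using integral_mono (integrable_const _) (integrableOn_unitBox hc) h1
  have hG1 : Continuous fun q : ℝ × Dom3 => ∫ t in Icc (0 : Dom3) 1, g q.1 q.2 t :=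
    continuous_parametric_integral_of_continuous (f := fun (q : ℝ × Dom3) t => g q.1 q.2 t)
      (hgc.comp (f := fun q : (ℝ × Dom3) × Dom3 => (q.1.1, q.1.2, q.2)) (by fun_prop))
      isCompact_Icc
  have hG2 : Continuous fun κ : ℝ => ∫ x in Icc (0 : Dom3) 1, ∫ t in Icc (0 : Dom3) 1, g κ x t :=
    continuous_parametric_integral_of_continuous
      (f := fun κ x => ∫ t in Icc (0 : Dom3) 1, g κ x t) hG1 isCompact_Icc
  simp only [← restrict_unitBox] at hG2
  have hlim := (hG2.tendsto 0).comp (tendsto_one_div_add_atTop_nhds_zero_nat (𝕜 := ℝ))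
  have := ge_of_tendsto' hlim hstep
  simpa only [hg, twoScaleShift_zero] using this

theorem sdqcEnvelope_le_patch {f : M33 → ℝ} (hf : ∀ a, 0 ≤ f a) (hfc : Continuous f)
    (ξ : M33) {φ : Dom3 → M33} (hφ : φ ∈ TestClass) {ι : Type*} [Fintype ι] [DecidableEq ι]
    {ψ : ι → Dom3 → M33} (hψ : ∀ j, ψ j ∈ TestClass) {J : Dom3 → ι}
    (hJ : ∀ j, MeasurableSet (J ⁻¹' {j})) (hJp : PeriodicZ3 J) :
    sdqcEnvelope f ξ ≤ ∫ x in unitBox, ∫ t in unitBox, f (ξ + φ x + ψ (J x) t) := by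
  have hind : ∀ j, PeriodicZ3 ((J ⁻¹' {j}).indicator fun _ => (1 : ℝ)) := fun j x m => by
    simp only [indicator, mem_preimage, hJp x m]
  choose η hη hηp hη01 hηl using fun j => exists_smooth_periodic_tendsto_indicator (hJ j) (hind j)
  set h : M33 → (ι → ℝ) → ℝ := fun a ρ => ∫ t in Icc (0 : Dom3) 1,
    f (ξ + (a + ∑ j, (ψ j t - fixedShift (ψ j) (ρ j) t))) with hh
  have hhc : Continuous (uncurry h) := by
    refine continuous_parametric_integral_of_continuous (f := fun (q : M33 × (ι → ℝ)) t =>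
      f (ξ + (q.1 + ∑ j, (ψ j t - fixedShift (ψ j) (q.2 j) t)))) ?_ isCompact_Icc
    have h1 := fun j => continuous_fixedShift (hψ j).1
    have h2 := fun j => (hψ j).1.continuous
    have h3 : ∀ j, Continuous fun x : (M33 × (ι → ℝ)) × Dom3 =>
        fixedShift (ψ j) (x.1.2 j) x.2 := fun j =>
      (h1 j).comp (f := fun x : (M33 × (ι → ℝ)) × Dom3 => (x.1.2 j, x.2)) (by fun_prop)
    unfold Function.uncurry
    fun_prop
  have hstep : ∀ n, sdqcEnvelope f ξ ≤ ∫ x in unitBox, h (φ x) fun j => η j n x := fun n => by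
    simpa only [hh, ← restrict_unitBox] using
      sdqcEnvelope_le_fixedShift hf hfc ξ hφ hψ (fun j => hη j n) fun j => hηp j n
  have hpt : ∀ x, h (φ x) (fun j => (J ⁻¹' {j}).indicator (fun _ => 1) x) =
      ∫ t in unitBox, f (ξ + φ x + ψ (J x) t) := by
    intro x
    simp only [hh, ← restrict_unitBox]
    refine integral_congr_ae (Eventually.of_forall fun t => ?_)
    dsimp only
    rw [Finset.sum_eq_single (J x)]
    · simp [fixedShift_one (hψ _), add_assoc]
    · intro j _ hj
      simp [indicator, hj.symm, fixedShift_zero]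
    · simp
  simp only [← hpt]
  obtain ⟨C, hC⟩ := ((isCompact_Icc.image hφ.1.continuous).prod
    (isCompact_Icc (a := (0 : ι → ℝ)) (b := 1))).exists_bound_of_continuousOn hhc.continuousOn
  refine ge_of_tendsto' (tendsto_integral_of_dominated_convergence
    (F := fun n x => h (φ x) fun j => η j n x) (fun _ => C) (fun n => ?_) (integrable_const C)
    (fun n => ?_) ?_) hstep
  · refine Continuous.aestronglyMeasurable (hhc.comp (f := fun x => (φ x, fun j => η j n x)) ?_)
    exact hφ.1.continuous.prodMk (continuous_pi fun j => (hη j n).continuous)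
  · filter_upwards [ae_restrict_mem measurableSet_unitBox] with x hx
    exact hC (φ x, fun j => η j n x) ⟨mem_image_of_mem _ (unitBox_subset_Icc hx),
      fun j => (hη01 j n x).1, fun j => (hη01 j n x).2⟩
  · refine ae_restrict_of_ae ((ae_all_iff.mpr hηl).mono fun x hx => ?_)
    exact (hhc.tendsto _).comp (tendsto_const_nhds.prodMk_nhds (tendsto_pi_nhds.mpr hx))

theorem symDivQC_sdqcEnvelope {f : M33 → ℝ} (hf : ∀ a, 0 ≤ f a) (hfc : Continuous f)
    (hQ : Continuous (sdqcEnvelope f)) : SymDivQC (sdqcEnvelope f) := by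
  intro ξ _ φ hφ
  refine le_of_forall_pos_le_add fun ε hε => ?_
  have hφc := hφ.1.continuous
  choose ψ hψ hψlt using fun a => exists_lt_of_sdqcEnvelope_lt
    (lt_add_of_pos_right (sdqcEnvelope f (ξ + a)) hε)
  have hcont : ∀ c, Continuous fun a => ∫ t in unitBox, f (ξ + a + ψ c t) := fun c => by
    rw [restrict_unitBox]
    refine continuous_parametric_integral_of_continuous
      (f := fun a t => f (ξ + a + ψ c t)) ?_ isCompact_Icc
    have := (hψ c).1.continuous
    unfold Function.uncurry
    fun_prop
  set U : M33 → Set M33 := fun c =>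
    {a | ∫ t in unitBox, f (ξ + a + ψ c t) < sdqcEnvelope f (ξ + a) + ε}
  have hU : ∀ c, IsOpen (U c) := fun c => isOpen_lt (hcont c) (by fun_prop)
  obtain ⟨T, hT⟩ := (isCompact_Icc.image hφc (s := Icc (0 : Dom3) 1)).elim_finite_subcover U hU
    fun a _ => mem_iUnion.mpr ⟨a, hψlt a⟩
  have hcov : ∀ x, ∃ i : Fin T.card, φ x ∈ U (T.equivFin.symm i) := by
    intro x
    have hx : φ x ∈ φ '' Icc 0 1 := by
      refine ⟨fun i => Int.fract (x i), ⟨fun i => Int.fract_nonneg _,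
        fun i => (Int.fract_lt_one _).le⟩, ?_⟩
      rw [← hφ.2.1 _ fun i => ⌊x i⌋]
      congr 1
      ext i
      simp
    obtain ⟨c, hc, hc'⟩ := mem_iUnion₂.mp (hT hx)
    exact ⟨T.equivFin ⟨c, hc⟩, by simpa using hc'⟩
  let P : Dom3 → Set (Fin T.card) := fun x => {i | φ x ∈ U (T.equivFin.symm i)}
  let J : Dom3 → Fin T.card := fun x => wellFounded_lt.min (P x) (hcov x)
  have hJmem : ∀ x, φ x ∈ U (T.equivFin.symm (J x)) := fun x => wellFounded_lt.min_mem (P x) (hcov x)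
  have hJset : ∀ j, J ⁻¹' {j} = {x | φ x ∈ U (T.equivFin.symm j)} ∩
      ⋂ i : {i // i < j}, {x | φ x ∈ U (T.equivFin.symm i)}ᶜ := by
    intro j
    ext x
    simp only [mem_preimage, mem_singleton_iff, mem_inter_iff, mem_ofPred_eq, mem_iInter,
      mem_compl_iff, Subtype.forall]
    constructor
    · rintro rfl
      exact ⟨hJmem x, fun i hi h => wellFounded_lt.not_lt_min (P x) h hi⟩
    · rintro ⟨h1, h2⟩
      refine le_antisymm (not_lt.mp fun h => wellFounded_lt.not_lt_min (P x) h1 h)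
        (not_lt.mp fun h => h2 _ h (hJmem x))
  have hmeas : ∀ i, MeasurableSet {x | φ x ∈ U (T.equivFin.symm i)} := fun i =>
    ((hU _).preimage hφc).measurableSet
  have hJ : ∀ j, MeasurableSet (J ⁻¹' {j}) := fun j => by
    rw [hJset]
    exact (hmeas j).inter (MeasurableSet.iInter fun i => (hmeas i).compl)
  have hJp : PeriodicZ3 J := fun x m => by
    have : P (x + fun i => (m i : ℝ)) = P x := by simp only [P, hφ.2.1 x m]
    simp only [J, this]
  have hmain := sdqcEnvelope_le_patch hf hfc ξ hφ (ψ := fun i : Fin T.card => ψ (T.equivFin.symm i))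
    (fun i => hψ _) hJ hJp
  have hQi : Integrable (fun x => sdqcEnvelope f (ξ + φ x)) (volume.restrict unitBox) :=
    integrableOn_unitBox (by fun_prop)
  refine hmain.trans ?_
  calc _ ≤ ∫ x in unitBox, (sdqcEnvelope f (ξ + φ x) + ε) := by
        refine integral_mono_of_nonneg (Eventually.of_forall fun x => integral_nonneg fun t => hf _)
          (hQi.add (integrable_const _)) (Eventually.of_forall fun x => (hJmem x).le)
    _ = _ := by
        rw [integral_add hQi (integrable_const _)]
        simp

end Quasiconvexity

section DistancePower

theorem exists_infDist_rpow_add_le (K : Set M33) {p : ℝ} (hp : 1 ≤ p) :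
    ∀ κ > 0, ∃ δ > 0, ∀ a h : M33, ‖h‖ < δ →
      Metric.infDist (a + h) K ^ p ≤ (1 + κ) * Metric.infDist a K ^ p + κ := by
  intro κ hκ
  have hp0 : 0 < p := by linarith
  have c1 : Continuous fun s : ℝ => (1 + s) ^ p := by
    exact (continuous_const.add continuous_id).rpow_const fun _ => Or.inr hp0.le
  have c2 : Continuous fun s : ℝ => (s + s ^ 2) ^ p := by
    exact (continuous_id.add (continuous_pow 2)).rpow_const fun _ => Or.inr hp0.le
  have e1 : ∀ᶠ s in 𝓝[>] (0 : ℝ), (1 + s) ^ p < 1 + κ :=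
    (c1.tendsto 0).eventually_lt_const (by simpa using hκ) |>.filter_mono nhdsWithin_le_nhds
  have e2 : ∀ᶠ s in 𝓝[>] (0 : ℝ), (s + s ^ 2) ^ p < κ :=
    (c2.tendsto 0).eventually_lt_const (by simpa [Real.zero_rpow hp0.ne'] using hκ)
      |>.filter_mono nhdsWithin_le_nhds
  obtain ⟨s, ⟨h1, h2⟩, hs⟩ := ((e1.and e2).and self_mem_nhdsWithin).exists
  have hs0 : 0 < s := hs
  refine ⟨s ^ 2, by positivity, fun a h hh => ?_⟩
  have hd : Metric.infDist (a + h) K ≤ Metric.infDist a K + s ^ 2 := by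
    refine (Metric.infDist_le_infDist_add_dist (x := a + h) (y := a)).trans ?_
    gcongr
    simpa [dist_eq_norm] using hh.le
  have hn := Metric.infDist_nonneg (x := a + h) (s := K)
  have hn' := Metric.infDist_nonneg (x := a) (s := K)
  have hpow : 0 ≤ Metric.infDist a K ^ p := Real.rpow_nonneg hn' _
  rcases le_total s (Metric.infDist a K) with hsd | hsd
  · calc Metric.infDist (a + h) K ^ p ≤ ((1 + s) * Metric.infDist a K) ^ p := by
          refine Real.rpow_le_rpow hn (hd.trans ?_) hp0.le
          nlinarith
      _ = (1 + s) ^ p * Metric.infDist a K ^ p := Real.mul_rpow (by positivity) hn'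
      _ ≤ (1 + κ) * Metric.infDist a K ^ p := by gcongr
      _ ≤ _ := by linarith
  · calc Metric.infDist (a + h) K ^ p ≤ (s + s ^ 2) ^ p :=
          Real.rpow_le_rpow hn (hd.trans (by linarith)) hp0.le
      _ ≤ κ := h2.le
      _ ≤ _ := by nlinarith

theorem hullInf_subset_hullP {K : Set M33} (hne : K.Nonempty) {p : ℝ} (hp : 1 ≤ p) :
    hullInf K ⊆ hullP K p := by
  rintro ξ ⟨hξ, h⟩
  refine ⟨hξ, ?_⟩
  have hp0 : 0 < p := by linarith
  set f : M33 → ℝ := fun η => Metric.infDist η K ^ p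
  have hf : ∀ a, 0 ≤ f a := fun a => Real.rpow_nonneg Metric.infDist_nonneg _
  have hfc : Continuous f := (Metric.continuous_infDist_pt K).rpow_const fun _ => Or.inr hp0.le
  have hQ := continuous_sdqcEnvelope hf hfc (exists_infDist_rpow_add_le K hp)
  refine le_antisymm ?_ (sdqcEnvelope_nonneg hf ξ)
  refine (h _ hQ (sdqcEnvelope_nonneg hf) (symDivQC_sdqcEnvelope hf hfc hQ)).trans ?_
  refine csSup_le (hne.image _) ?_
  rintro _ ⟨a, ha, rfl⟩
  refine (sdqcEnvelope_le_self hf a).trans ?_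
  simp [f, Metric.infDist_zero_of_mem ha, Real.zero_rpow hp0.ne']

end DistancePower

section VariableScale

/-- The standard bump function at the origin. -/
def stdBump : ContDiffBump (0 : Dom3) where
  rIn := 1 / 2
  rOut := 1
  rIn_pos := by norm_num
  rIn_lt_rOut := by norm_num

/-- Mollification at the variable scale `1 / s`. -/
def scaleMoll (s : Dom3 → ℝ) (χ : Dom3 → ℝ) (k : ℕ) (x : Dom3) : ℝ :=
  ∫ y, s y ^ k * χ (s y • (x - y))

variable {s χ : Dom3 → ℝ} {r₀ : ℝ}

theorem contDiff_scaleKernel (hχ : ContDiff ℝ ∞ χ) (k : ℕ) :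
    ContDiff ℝ ∞ (uncurry fun (x : Dom3) (q : Dom3 × ℝ) => q.2 ^ k * χ (q.2 • (x - q.1))) := by
  fun_prop

/-- A localized form of the variable scale mollification. -/
theorem scaleMoll_eq_setIntegral (hs : Continuous s) (hs1 : ∀ y, 1 ≤ s y)
    (hχs : ∀ z, 1 ≤ ‖z‖ → χ z = 0) (k : ℕ) {x₀ x : Dom3} (hx : ‖x - x₀‖ ≤ 1) :
    scaleMoll s χ k x = ∫ q in (fun y => (y, s y)) '' Metric.closedBall x₀ 2,
      q.2 ^ k * χ (q.2 • (x - q.1))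
        ∂((volume.restrict (Metric.closedBall x₀ 2)).map fun y => (y, s y)) := by
  have hemb : MeasurableEmbedding fun y => (y, s y) :=
    (LeftInverse.isClosedEmbedding (f := Prod.fst) (fun _ => rfl) continuous_fst
      (continuous_id.prodMk hs)).measurableEmbedding
  rw [hemb.setIntegral_map, preimage_image_eq _ hemb.injective,
    Measure.restrict_restrict Metric.isClosed_closedBall.measurableSet, inter_self]
  symm
  refine setIntegral_eq_integral_of_forall_compl_eq_zero fun y hy => ?_
  rw [hχs, mul_zero]
  have h1 : 2 < ‖y - x₀‖ := by simpa [dist_eq_norm] using hy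
  have h2 : ‖y - x₀‖ ≤ ‖x - y‖ + ‖x - x₀‖ := by
    rw [norm_sub_rev x y]
    simpa using norm_add_le (y - x) (x - x₀)
  rw [norm_smul, Real.norm_of_nonneg (by linarith [hs1 y])]
  nlinarith [hs1 y]

theorem contDiff_scaleMoll (hs : Continuous s) (hs1 : ∀ y, 1 ≤ s y) (hχ : ContDiff ℝ ∞ χ)
    (hχs : ∀ z, 1 ≤ ‖z‖ → χ z = 0) (k : ℕ) : ContDiff ℝ ∞ (scaleMoll s χ k) := by
  refine contDiff_iff_contDiffAt.mpr fun x₀ => ?_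
  have : IsFiniteMeasure (volume.restrict (Metric.closedBall x₀ (2 : ℝ))) :=
    isFiniteMeasure_restrict.mpr measure_closedBall_lt_top.ne
  have h := contDiff_setIntegral_of_contDiff (contDiff_scaleKernel hχ k)
    ((volume.restrict (Metric.closedBall x₀ 2)).map fun y => (y, s y))
    ((isCompact_closedBall x₀ 2).image (continuous_id.prodMk hs))
  refine h.contDiffAt.congr_of_eventuallyEq ?_
  filter_upwards [Metric.closedBall_mem_nhds x₀ one_pos] with x hx
  exact scaleMoll_eq_setIntegral hs hs1 hχs k (by simpa [dist_eq_norm] using hx)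

theorem pd_eq_zero_of_one_le (hχ : ContDiff ℝ ∞ χ) (hχs : ∀ z, 1 ≤ ‖z‖ → χ z = 0) (i : Fin 3) :
    ∀ z, 1 ≤ ‖z‖ → pd i χ z = 0 := by
  intro z hz
  have hcl : IsClosed {z | pd i χ z = 0} := isClosed_eq (contDiff_pd hχ i).continuous continuous_const
  have hsub : {z : Dom3 | 1 < ‖z‖} ⊆ {z | pd i χ z = 0} := by
    intro y hy
    have : χ =ᶠ[𝓝 y] fun _ => 0 := by
      filter_upwards [(isOpen_lt continuous_const continuous_norm).mem_nhds hy] with u hu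
      exact hχs u (le_of_lt hu)
    exact (pd_congr this i).trans (pd_const 0 i y)
  have hz0 : Tendsto (fun t : ℝ => t • z) (𝓝[>] 1) (𝓝 z) := by
    have : Continuous fun t : ℝ => t • z := by fun_prop
    simpa using (this.tendsto 1).mono_left nhdsWithin_le_nhds
  refine hcl.mem_of_tendsto hz0 ?_
  filter_upwards [self_mem_nhdsWithin] with t ht
  apply hsub
  have ht' : 1 < t := ht
  change 1 < ‖t • z‖
  rw [norm_smul, Real.norm_of_nonneg (by linarith)]
  nlinarith

theorem pd_scaleMoll (hs : Continuous s) (hs1 : ∀ y, 1 ≤ s y) (hχ : ContDiff ℝ ∞ χ)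
    (hχs : ∀ z, 1 ≤ ‖z‖ → χ z = 0) (k : ℕ) (i : Fin 3) (x : Dom3) :
    pd i (scaleMoll s χ k) x = scaleMoll s (pd i χ) (k + 1) x := by
  have hS : IsCompact ((fun y => (y, s y)) '' Metric.closedBall x 2) :=
    (isCompact_closedBall x 2).image (continuous_id.prodMk hs)
  have : IsFiniteMeasure (volume.restrict (Metric.closedBall x (2 : ℝ))) :=
    isFiniteMeasure_restrict.mpr measure_closedBall_lt_top.ne
  set μ := (volume.restrict (Metric.closedBall x 2)).map fun y => (y, s y)
  have hG := contDiff_scaleKernel hχ k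
  have h := hasFDerivAt_setIntegral_of_contDiff hG μ hS x
  have he : scaleMoll s χ k =ᶠ[𝓝 x] fun x' =>
      ∫ q in (fun y => (y, s y)) '' Metric.closedBall x 2, q.2 ^ k * χ (q.2 • (x' - q.1)) ∂μ := by
    filter_upwards [Metric.closedBall_mem_nhds x one_pos] with x' hx
    exact scaleMoll_eq_setIntegral hs hs1 hχs k (by simpa [dist_eq_norm] using hx)
  have hint : IntegrableOn (fun q : Dom3 × ℝ => fderiv ℝ (fun y => q.2 ^ k * χ (q.2 • (y - q.1))) x)
      ((fun y => (y, s y)) '' Metric.closedBall x 2) μ := by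
    have := (contDiff_fderiv_param hG).continuous
    exact (this.comp (f := fun q : Dom3 × ℝ => (x, q)) (by fun_prop)).continuousOn.integrableOn_compact hS
  rw [pd_congr he, pd, h.fderiv, ContinuousLinearMap.integral_apply hint,
    scaleMoll_eq_setIntegral hs hs1 (pd_eq_zero_of_one_le hχ hχs i) (k + 1) (x₀ := x) (by simp)]
  congr 1
  ext q
  have hd : HasFDerivAt (fun y : Dom3 => q.2 • (y - q.1)) (q.2 • ContinuousLinearMap.id ℝ Dom3) x :=
    ((hasFDerivAt_id x).sub_const q.1).const_smul q.2
  have := (((hχ.differentiable (by simp) (q.2 • (x - q.1))).hasFDerivAt.comp x hd).const_mul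
    (q.2 ^ k)).fderiv
  erw [this]
  simp [pd]
  ring

end VariableScale

section ScaleBounds

variable {R χ : Dom3 → ℝ}

theorem volume_real_closedBall_dom3 (x : Dom3) {t : ℝ} (ht : 0 ≤ t) :
    volume.real (Metric.closedBall x t) = (2 * t) ^ 3 := by
  rw [Measure.real, Real.volume_pi_closedBall x ht, ENNReal.toReal_ofReal (by positivity)]
  simp

theorem continuous_of_quarter_lipschitz (hR : ∀ x y, R x ≤ R y + ‖x - y‖ / 4) : Continuous R := by
  refine (LipschitzWith.of_le_add_mul 1 fun x y => ?_).continuous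
  rw [dist_eq_norm]
  have := hR x y
  have := norm_nonneg (x - y)
  simp only [NNReal.coe_one]
  linarith

theorem abs_scaleMoll_le {M : ℝ} (hM : ∀ z, |χ z| ≤ M) (hχs : ∀ z, 1 ≤ ‖z‖ → χ z = 0)
    (h0 : ∀ x, 0 < R x) (hR : ∀ x y, R x ≤ R y + ‖x - y‖ / 4) (k : ℕ) (x : Dom3) :
    |scaleMoll (fun y => (R y)⁻¹) χ k x| ≤ M * (2 / R x) ^ k * (4 * R x) ^ 3 := by
  have hM0 : 0 ≤ M := (abs_nonneg _).trans (hM 0)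
  have hRx := h0 x
  have hout : ∀ y, R y ≤ ‖x - y‖ → (R y)⁻¹ ^ k * χ ((R y)⁻¹ • (x - y)) = 0 := by
    intro y hy
    rw [hχs, mul_zero]
    rw [norm_smul, Real.norm_of_nonneg (by have := h0 y; positivity), inv_mul_eq_div,
      one_le_div (h0 y)]
    exact hy
  have heq : scaleMoll (fun y => (R y)⁻¹) χ k x = ∫ y in Metric.closedBall x (2 * R x),
      (R y)⁻¹ ^ k * χ ((R y)⁻¹ • (x - y)) := by
    symm
    refine setIntegral_eq_integral_of_forall_compl_eq_zero fun y hy => hout y ?_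
    have h1 : 2 * R x < ‖x - y‖ := by simpa [dist_eq_norm, norm_sub_rev] using hy
    have h2 := hR y x
    rw [norm_sub_rev] at h2
    linarith
  have hb := norm_setIntegral_le_of_norm_le_const (μ := volume) (s := Metric.closedBall x (2 * R x))
    (f := fun y => (R y)⁻¹ ^ k * χ ((R y)⁻¹ • (x - y))) (C := M * (2 / R x) ^ k)
    measure_closedBall_lt_top ?_
  · rw [← heq, volume_real_closedBall_dom3 x (by positivity), Real.norm_eq_abs,
      show 2 * (2 * R x) = 4 * R x by ring] at hb
    exact hb
  · intro y _
    rcases le_or_gt (R y) ‖x - y‖ with h | h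
    · rw [hout y h]
      simp only [norm_zero]
      positivity
    · have hRy := h0 y
      rw [norm_mul, mul_comm, norm_pow, Real.norm_of_nonneg (inv_nonneg.mpr hRy.le)]
      have h2 := hR x y
      refine mul_le_mul (hM _) (pow_le_pow_left₀ (by positivity) ?_ k) (by positivity) hM0
      rw [inv_eq_one_div, div_le_div_iff₀ hRy hRx]
      linarith

theorem le_scaleMoll_stdBump (h0 : ∀ x, 0 < R x) (h1 : ∀ x, R x ≤ 1) (hR : ∀ x y, R x ≤ R y + ‖x - y‖ / 4)
    (x : Dom3) : R x / 20 ≤ scaleMoll (fun y => (R y)⁻¹) stdBump 2 x := by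
  have hRx := h0 x
  have hc : Continuous fun y => (R y)⁻¹ :=
    (continuous_of_quarter_lipschitz hR).inv₀ fun y => (h0 y).ne'
  have hcont : Continuous fun y => (R y)⁻¹ ^ 2 * stdBump ((R y)⁻¹ • (x - y)) := by
    have := stdBump.continuous
    fun_prop
  have hint : Integrable fun y => (R y)⁻¹ ^ 2 * stdBump ((R y)⁻¹ • (x - y)) := by
    refine hcont.integrable_of_hasCompactSupport ?_
    refine HasCompactSupport.intro (isCompact_closedBall x 1) fun y hy => ?_
    have hy' : 1 < dist y x := by simpa using hy
    rw [stdBump.zero_of_le_dist, mul_zero]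
    have hRy := h0 y
    rw [dist_zero_right, norm_smul, Real.norm_of_nonneg (by positivity), inv_mul_eq_div,
      ← dist_eq_norm, dist_comm]
    rw [le_div_iff₀ hRy]
    have := h1 y
    change 1 * R y ≤ _
    linarith
  have hnn : ∀ y, 0 ≤ (R y)⁻¹ ^ 2 * stdBump ((R y)⁻¹ • (x - y)) := fun y =>
    mul_nonneg (by positivity) stdBump.nonneg
  calc R x / 20 ≤ ∫ y in Metric.closedBall x (R x / 3), (1 / (4 * R x ^ 2) : ℝ) := by
        rw [setIntegral_const, volume_real_closedBall_dom3 x (by positivity), smul_eq_mul]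
        field_simp
        norm_num
    _ ≤ ∫ y in Metric.closedBall x (R x / 3), (R y)⁻¹ ^ 2 * stdBump ((R y)⁻¹ • (x - y)) := by
        refine setIntegral_mono_on (integrableOn_const measure_closedBall_lt_top.ne)
          hint.integrableOn Metric.isClosed_closedBall.measurableSet fun y hy => ?_
        have hd : ‖x - y‖ ≤ R x / 3 := by simpa [dist_eq_norm, norm_sub_rev] using hy
        have hRy := h0 y
        have a1 := hR x y
        have a2 := hR y x
        rw [norm_sub_rev] at a2
        rw [stdBump.one_of_mem_closedBall, mul_one, inv_pow, inv_eq_one_div]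
        · refine one_div_le_one_div_of_le (by positivity) ?_
          nlinarith
        · rw [mem_closedBall_zero_iff, norm_smul, Real.norm_of_nonneg (by positivity),
            inv_mul_eq_div, div_le_iff₀ hRy]
          change _ ≤ 1 / 2 * _
          linarith
    _ ≤ _ := setIntegral_le_integral hint (Eventually.of_forall hnn)

theorem scaleMoll_eventually_const {r₀ : ℝ} (h₀ : 0 < r₀) (hr₀ : ∀ x, r₀ ≤ R x)
    (hR : ∀ x y, R x ≤ R y + ‖x - y‖ / 4) (hχs : ∀ z, 1 ≤ ‖z‖ → χ z = 0) (k : ℕ) {x : Dom3}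
    (hx : ∀ y, ‖y - x‖ < 2 * r₀ → R y = r₀) :
    ∃ c, scaleMoll (fun y => (R y)⁻¹) χ k =ᶠ[𝓝 x] fun _ => c := by
  refine ⟨∫ y, r₀⁻¹ ^ k * χ (r₀⁻¹ • y), ?_⟩
  filter_upwards [Metric.ball_mem_nhds x (half_pos h₀)] with x' hx'
  have hd : ‖x' - x‖ < r₀ / 2 := by simpa [dist_eq_norm] using hx'
  rw [← integral_sub_left_eq_self (fun y => r₀⁻¹ ^ k * χ (r₀⁻¹ • y)) volume x', scaleMoll]
  congr 1
  ext y
  by_cases hy : ‖y - x‖ < 2 * r₀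
  · rw [hx y hy]
  · have hfar : 3 / 2 * r₀ ≤ ‖x' - y‖ := by
      have : ‖y - x‖ ≤ ‖x' - y‖ + ‖x' - x‖ := by
        rw [norm_sub_rev x' y]
        simpa using norm_add_le (y - x') (x' - x)
      linarith
    have hRy : R y ≤ ‖x' - y‖ := by
      have h1 := hR y x'
      rw [hx x' (by linarith), norm_sub_rev] at h1
      linarith
    have hpos : 0 < R y := h₀.trans_le (hr₀ y)
    rw [hχs, hχs]
    · simp
    · rw [norm_smul, Real.norm_of_nonneg (by positivity), inv_mul_eq_div, one_le_div h₀]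
      linarith
    · rw [norm_smul, Real.norm_of_nonneg (by positivity), inv_mul_eq_div, one_le_div hpos]
      exact hRy

theorem PeriodicZ3.scaleMoll {s : Dom3 → ℝ} (hs : PeriodicZ3 s) (k : ℕ) : PeriodicZ3 (scaleMoll s χ k) := by
  intro x m
  simp only [_root_.scaleMoll]
  rw [← integral_add_right_eq_self _ fun i => (m i : ℝ)]
  simp only [hs _ m, add_sub_add_right_eq_sub]

theorem exists_smooth_scale : ∃ C : ℝ, 1 ≤ C ∧ ∀ (R : Dom3 → ℝ) (r₀ : ℝ), 0 < r₀ →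
    (∀ x, r₀ ≤ R x) → (∀ x, R x ≤ 1) → (∀ x y, R x ≤ R y + ‖x - y‖ / 4) → PeriodicZ3 R →
    ∃ r : Dom3 → ℝ, ContDiff ℝ ∞ r ∧ PeriodicZ3 r ∧ (∀ x, 2 * R x ≤ r x) ∧ (∀ x, r x ≤ C * R x) ∧
      (∀ x i, |pd i r x| ≤ C) ∧ (∀ x i j, |scaleHess r x i j| ≤ C) ∧
      ∀ x, (∀ y, ‖y - x‖ < 2 * r₀ → R y = r₀) →
        (∀ i, pd i r x = 0) ∧ ∀ i j, scaleHess r x i j = 0 := by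
  let χ : Dom3 → ℝ := stdBump
  have hχ : ContDiff ℝ ∞ χ := stdBump.contDiff
  have hχs : ∀ z, 1 ≤ ‖z‖ → χ z = 0 := fun z hz => stdBump.zero_of_le_dist (by simpa [stdBump] using hz)
  have hbd : ∀ f : Dom3 → ℝ, ContDiff ℝ ∞ f → (∀ z, 1 ≤ ‖z‖ → f z = 0) → ∃ M, ∀ z, |f z| ≤ M := by
    intro f hf hfs
    exact hf.continuous.bounded_above_of_compact_support
      (HasCompactSupport.intro (isCompact_closedBall 0 1) fun y hy => hfs y (by
        have : 1 < ‖y‖ := by simpa using hy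
        exact this.le))
  have hχ1 := fun i => pd_eq_zero_of_one_le hχ hχs i
  have hχ2 := fun i j => pd_eq_zero_of_one_le (contDiff_pd hχ j) (hχ1 j) i
  obtain ⟨M₀, hM₀⟩ := hbd χ hχ hχs
  choose M₁ hM₁ using fun i => hbd (pd i χ) (contDiff_pd hχ i) (hχ1 i)
  choose M₂ hM₂ using fun i j => hbd (pd i (pd j χ)) (contDiff_pd (contDiff_pd hχ j) i) (hχ2 i j)
  let M := M₀ + (∑ i, |M₁ i|) + ∑ i, ∑ j, |M₂ i j|
  have hM₀0 : 0 ≤ M₀ := (abs_nonneg _).trans (hM₀ 0)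
  have hS1 : 0 ≤ ∑ i, |M₁ i| := Finset.sum_nonneg fun _ _ => abs_nonneg _
  have hS2 : 0 ≤ ∑ i, ∑ j, |M₂ i j| :=
    Finset.sum_nonneg fun _ _ => Finset.sum_nonneg fun _ _ => abs_nonneg _
  have hM : 0 ≤ M := by positivity
  have b0 : ∀ z, |χ z| ≤ M := fun z => (hM₀ z).trans (by simp only [M]; linarith)
  have b1 : ∀ i z, |pd i χ z| ≤ M := fun i z => by
    have := Finset.single_le_sum (f := fun i => |M₁ i|) (fun _ _ => abs_nonneg _) (Finset.mem_univ i)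
    have := (hM₁ i z).trans (le_abs_self _)
    simp only [M]
    linarith
  have b2 : ∀ i j z, |pd i (pd j χ) z| ≤ M := fun i j z => by
    have h1 := Finset.single_le_sum (f := fun j => |M₂ i j|) (fun _ _ => abs_nonneg _) (Finset.mem_univ j)
    have h2 := Finset.single_le_sum (f := fun i => ∑ j, |M₂ i j|)
      (fun _ _ => Finset.sum_nonneg fun _ _ => abs_nonneg _) (Finset.mem_univ i)
    have := (hM₂ i j z).trans (le_abs_self _)
    simp only [M]
    linarith
  let N := 40 * (M * 1024)
  have hN : 0 ≤ N := by positivity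
  refine ⟨1 + N + N ^ 2 + N ^ 2, by nlinarith [sq_nonneg N], fun R r₀ h₀ hr₀ h1 hR hp => ?_⟩
  have h0 : ∀ x, 0 < R x := fun x => h₀.trans_le (hr₀ x)
  let s : Dom3 → ℝ := fun y => (R y)⁻¹
  have hs : Continuous s := (continuous_of_quarter_lipschitz hR).inv₀ fun y => (h0 y).ne'
  have hs1 : ∀ y, 1 ≤ s y := fun y => (one_le_inv₀ (h0 y)).mpr (h1 y)
  have hsp : PeriodicZ3 s := fun x m => by simp only [s, hp x m]
  have hI := contDiff_scaleMoll hs hs1 hχ hχs 2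
  let r : Dom3 → ℝ := fun x => 40 * scaleMoll s χ 2 x
  have hr : ContDiff ℝ ∞ r := contDiff_const.mul hI
  have e1 : ∀ i x, pd i r x = 40 * scaleMoll s (pd i χ) 3 x := fun i x => by
    simp only [r]
    rw [pd_const_mul _ hI, pd_scaleMoll hs hs1 hχ hχs]
  have e2 : ∀ i j x, pd i (pd j r) x = 40 * scaleMoll s (pd i (pd j χ)) 4 x := fun i j x => by
    have : pd j r = fun x => 40 * scaleMoll s (pd j χ) 3 x := funext (e1 j)
    rw [this, pd_const_mul _ (contDiff_scaleMoll hs hs1 (contDiff_pd hχ j) (hχ1 j) 3),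
      pd_scaleMoll hs hs1 (contDiff_pd hχ j) (hχ1 j)]
  have c0 : ∀ x, |r x| ≤ N * R x := fun x => by
    have h := abs_scaleMoll_le b0 hχs h0 hR 2 x
    have hx := h0 x
    have : M * (2 / R x) ^ 2 * (4 * R x) ^ 3 ≤ M * 1024 * R x := by
      have : M * (2 / R x) ^ 2 * (4 * R x) ^ 3 = M * 256 * R x := by field_simp; ring
      rw [this]
      nlinarith [mul_nonneg hM hx.le]
    simp only [r, abs_mul, N, abs_of_pos (show (0 : ℝ) < 40 by norm_num)]
    linarith
  have c1 : ∀ x i, |pd i r x| ≤ N := fun x i => by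
    have h := abs_scaleMoll_le (b1 i) (hχ1 i) h0 hR 3 x
    have hx := h0 x
    have : M * (2 / R x) ^ 3 * (4 * R x) ^ 3 = M * 512 := by field_simp; ring
    rw [e1, abs_mul, abs_of_pos (show (0 : ℝ) < 40 by norm_num)]
    simp only [N]
    linarith
  have c2 : ∀ x i j, |pd i (pd j r) x| ≤ N / R x := fun x i j => by
    have h := abs_scaleMoll_le (b2 i j) (hχ2 i j) h0 hR 4 x
    have hx := h0 x
    have : M * (2 / R x) ^ 4 * (4 * R x) ^ 3 = M * 1024 / R x := by field_simp; ring
    rw [e2, abs_mul, abs_of_pos (show (0 : ℝ) < 40 by norm_num)]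
    simp only [N]
    rw [mul_div_assoc]
    linarith
  refine ⟨r, hr, ?_, fun x => ?_, fun x => ?_, fun x i => ?_, fun x i j => ?_, fun x hx => ?_⟩
  · intro x m
    simp only [r, hsp.scaleMoll 2 x m]
  · have := le_scaleMoll_stdBump h0 h1 hR x
    simp only [r, s, χ]
    linarith
  · refine (le_abs_self _).trans ((c0 x).trans (mul_le_mul_of_nonneg_right ?_ (h0 x).le))
    nlinarith [sq_nonneg N]
  · exact (c1 x i).trans (by nlinarith [sq_nonneg N])
  · refine (abs_add_le _ _).trans ?_
    rw [abs_mul, abs_mul]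
    have h1 : |pd i r x| * |pd j r x| ≤ N * N :=
      mul_le_mul (c1 x i) (c1 x j) (abs_nonneg _) hN
    have h2 : |r x| * |pd i (pd j r) x| ≤ (N * R x) * (N / R x) :=
      mul_le_mul (c0 x) (c2 x i j) (abs_nonneg _) (mul_nonneg hN (h0 x).le)
    have h3 : (N * R x) * (N / R x) = N * N := by
      have := (h0 x).ne'
      field_simp
    nlinarith
  · obtain ⟨c, hc⟩ := scaleMoll_eventually_const h₀ hr₀ hR hχs 2 hx
    have hrc : r =ᶠ[𝓝 x] fun _ => 40 * c := by
      filter_upwards [hc] with y hy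
      simp only [r, s, hy]
    have hp1 : ∀ i, pd i r =ᶠ[𝓝 x] fun _ => 0 := fun i => by
      filter_upwards [hrc.eventuallyEq_nhds] with y hy
      exact (pd_congr hy i).trans (pd_const _ i y)
    refine ⟨fun i => (hp1 i).self_of_nhds, fun i j => ?_⟩
    rw [scaleHess, (hp1 i).self_of_nhds, pd_congr (hp1 j) i, pd_const]
    ring

end ScaleBounds

section TransportKernel

/-- The normalized bump function. -/
def bumpWeight : Dom3 → ℝ := stdBump.normed volume

theorem contDiff_bumpWeight : ContDiff ℝ ∞ bumpWeight := stdBump.contDiff_normed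

theorem bumpWeight_eq_zero {z : Dom3} (hz : 1 ≤ ‖z‖) : bumpWeight z = 0 := by
  have h : z ∉ support (stdBump.normed (volume : Measure Dom3)) := by
    rw [stdBump.support_normed_eq]
    simpa [stdBump] using hz
  exact notMem_support.mp h

theorem setIntegral_bumpWeight : ∫ z in Metric.closedBall 0 1, bumpWeight z = 1 := by
  rw [setIntegral_eq_integral_of_forall_compl_eq_zero, bumpWeight, stdBump.integral_normed]
  intro z hz
  have : 1 < ‖z‖ := by simpa using hz
  exact bumpWeight_eq_zero this.le

/-- The average of the transported fields over the shifts in the unit ball. -/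
def ballTransport (r : Dom3 → ℝ) (φ : Dom3 → M33) : Dom3 → M33 :=
  shiftOp (Metric.closedBall 0 1) bumpWeight id r φ

/-- Integral kernel of `ballTransport`. -/
def transportKernel (z : Dom3) (p : Dom3) (Q : Fin 3 → Dom3) (α β γ δ : Fin 3) : ℝ :=
  bumpWeight z * shiftCoef z Q α β γ δ
    + ∑ k, pd k (fun z => bumpWeight z * (shiftAdj z p α γ * shiftAdj z p β δ) * z k) z

theorem setIntegral_mul_pd {a g : Dom3 → ℝ} (ha : ContDiff ℝ ∞ a) (has : ∀ z, 1 ≤ ‖z‖ → a z = 0)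
    (hg : ContDiff ℝ ∞ g) (k : Fin 3) :
    ∫ z in Metric.closedBall 0 1, a z * pd k g z = -∫ z in Metric.closedBall 0 1, pd k a z * g z := by
  have hout : ∀ z : Dom3, z ∉ Metric.closedBall (0 : Dom3) 1 → 1 ≤ ‖z‖ := fun z hz => by
    have : 1 < ‖z‖ := by simpa using hz
    exact this.le
  have has' := pd_eq_zero_of_one_le ha has k
  rw [setIntegral_eq_integral_of_forall_compl_eq_zero fun z hz => by rw [has z (hout z hz), zero_mul],
    setIntegral_eq_integral_of_forall_compl_eq_zero fun z hz => by rw [has' z (hout z hz), zero_mul]]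
  have hint : ∀ {u v : Dom3 → ℝ}, Continuous u → (∀ z, 1 ≤ ‖z‖ → u z = 0) → Continuous v →
      Integrable fun z => u z * v z := fun hu hus hv =>
    (hu.mul hv).integrable_of_hasCompactSupport
      (HasCompactSupport.intro (isCompact_closedBall 0 1) fun z hz => by
        simp only [Pi.mul_apply]
        rw [hus z (hout z hz), zero_mul])
  exact integral_mul_fderiv_eq_neg_fderiv_mul_of_integrable
    (hint (contDiff_pd ha k).continuous has' hg.continuous)
    (hint ha.continuous has (contDiff_pd hg k).continuous)
    (hint ha.continuous has hg.continuous)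
    (fun z _ => ha.differentiable (by simp) z) fun z _ => hg.differentiable (by simp) z

theorem pd_comp_affine {f : Dom3 → ℝ} (hf : ContDiff ℝ ∞ f) (ρ : ℝ) (x : Dom3) (k : Fin 3) (z : Dom3) :
    pd k (fun z => f (x + ρ • z)) z = ρ * pd k f (x + ρ • z) := by
  have hd : HasFDerivAt (fun y : Dom3 => x + ρ • y) (ρ • ContinuousLinearMap.id ℝ Dom3) z :=
    ((hasFDerivAt_id z).const_smul ρ).const_add x
  have := ((hf.differentiable (by simp) (x + ρ • z)).hasFDerivAt.comp z hd).fderiv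
  rw [pd]
  erw [this]
  simp [pd]

theorem integrableOn_unitBall {f : Dom3 → ℝ} (hf : Continuous f) :
    IntegrableOn f (Metric.closedBall 0 1) :=
  hf.continuousOn.integrableOn_compact (isCompact_closedBall 0 1)

theorem setIntegral_mul_dirDeriv {a f : Dom3 → ℝ} (ha : ContDiff ℝ ∞ a)
    (has : ∀ z, 1 ≤ ‖z‖ → a z = 0) (hf : ContDiff ℝ ∞ f) (ρ : ℝ) (x : Dom3) :
    ∫ z in Metric.closedBall 0 1, a z * (ρ * dirDeriv z f (x + ρ • z))
      = -∫ z in Metric.closedBall 0 1, (∑ k, pd k (fun z => a z * z k) z) * f (x + ρ • z) := by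
  have hk : ∀ k, ContDiff ℝ ∞ fun z : Dom3 => a z * z k := fun k => ha.mul (contDiff_apply _ _ k)
  have hg : ContDiff ℝ ∞ fun z => f (x + ρ • z) := by fun_prop
  have e1 : ∀ z, a z * (ρ * dirDeriv z f (x + ρ • z))
      = ∑ k, (a z * z k) * pd k (fun z => f (x + ρ • z)) z := fun z => by
    simp only [dirDeriv, Finset.mul_sum, pd_comp_affine hf]
    exact Finset.sum_congr rfl fun k _ => by ring
  have c1 : ∀ k, Continuous fun z => (a z * z k) * pd k (fun z => f (x + ρ • z)) z := fun k =>
    (hk k).continuous.mul (contDiff_pd hg k).continuous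
  have c2 : ∀ k, Continuous fun z => pd k (fun z => a z * z k) z * f (x + ρ • z) := fun k =>
    (contDiff_pd (hk k) k).continuous.mul hg.continuous
  simp only [e1, Finset.sum_mul]
  rw [integral_finsetSum _ fun k _ => integrableOn_unitBall (c1 k),
    integral_finsetSum _ fun k _ => integrableOn_unitBall (c2 k), ← Finset.sum_neg_distrib]
  exact Finset.sum_congr rfl fun k _ =>
    setIntegral_mul_pd (hk k) (fun z hz => by rw [has z hz, zero_mul]) hg k

theorem contDiff_shiftAdj_param (α γ : Fin 3) :
    ContDiff ℝ ∞ fun q : Dom3 × Dom3 => shiftAdj q.2 q.1 α γ := by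
  unfold shiftAdj
  fun_prop

theorem contDiff_shiftCoef_param (α β γ δ : Fin 3) :
    ContDiff ℝ ∞ fun q : Dom3 × (Fin 3 → Dom3) => shiftCoef q.1 q.2 α β γ δ := by
  unfold shiftCoef
  fun_prop

theorem continuous_transportKernel (α β γ δ : Fin 3) :
    Continuous fun q : Dom3 × Dom3 × (Fin 3 → Dom3) => transportKernel q.1 q.2.1 q.2.2 α β γ δ := by
  have h1 := (contDiff_shiftCoef_param α β γ δ).continuous
  have h2 : ∀ k, Continuous fun q : Dom3 × Dom3 => pd k (fun z => bumpWeight z *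
      (shiftAdj z q.2 α γ * shiftAdj z q.2 β δ) * z k) q.1 := fun k => by
    have hG : ContDiff ℝ ∞ (uncurry fun (z p : Dom3) => bumpWeight z *
        (shiftAdj z p α γ * shiftAdj z p β δ) * z k) := by
      have a := contDiff_bumpWeight
      have b := fun α γ => (contDiff_shiftAdj_param α γ).comp (contDiff_snd.prodMk contDiff_fst)
      exact ((a.comp contDiff_fst).mul ((b α γ).mul (b β δ))).mul
        ((contDiff_apply ℝ ℝ k).comp contDiff_fst)
    exact (contDiff_fderiv_param hG).continuous.clm_apply continuous_const
  have h3 := contDiff_bumpWeight.continuous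
  refine ((h3.comp continuous_fst).mul (h1.comp (f := fun q : Dom3 × Dom3 × (Fin 3 → Dom3) =>
    (q.1, q.2.2)) (by fun_prop))).add ?_
  exact continuous_finsetSum _ fun k _ => (h2 k).comp
    (f := fun q : Dom3 × Dom3 × (Fin 3 → Dom3) => (q.1, q.2.1)) (by fun_prop)

theorem setIntegral_bumpWeight_mul_shiftForm {φ : Dom3 → M33} (hφ : ContDiff ℝ ∞ φ) (p : Dom3)
    (Q : Fin 3 → Dom3) (ρ : ℝ) (x : Dom3) (α β : Fin 3) :
    ∫ z in Metric.closedBall 0 1, bumpWeight z * shiftForm z p Q (fun γ δ => φ (x + ρ • z) (γ, δ))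
        (fun γ δ => ρ * dirDeriv z (fun y => φ y (γ, δ)) (x + ρ • z)) α β
      = ∑ γ, ∑ δ, ∫ z in Metric.closedBall 0 1,
        transportKernel z p Q α β γ δ * φ (x + ρ • z) (γ, δ) := by
  have hW := contDiff_bumpWeight
  have hf := fun γ δ => contDiff_coord hφ γ δ
  have hA : ∀ α γ, ContDiff ℝ ∞ fun z : Dom3 => shiftAdj z p α γ := fun α γ =>
    (contDiff_shiftAdj_param α γ).comp (contDiff_const.prodMk contDiff_id)
  have hB : ∀ γ δ, ContDiff ℝ ∞ fun z : Dom3 => shiftCoef z Q α β γ δ := fun γ δ => by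
    unfold shiftCoef
    fun_prop
  have ha : ∀ γ δ, ContDiff ℝ ∞ fun z => bumpWeight z * (shiftAdj z p α γ * shiftAdj z p β δ) :=
    fun γ δ => hW.mul ((hA α γ).mul (hA β δ))
  have has : ∀ γ δ, ∀ z : Dom3, 1 ≤ ‖z‖ → bumpWeight z * (shiftAdj z p α γ * shiftAdj z p β δ) = 0 :=
    fun γ δ z hz => by rw [bumpWeight_eq_zero hz, zero_mul]
  have hfs : ∀ γ δ, Continuous fun z => φ (x + ρ • z) (γ, δ) := fun γ δ =>
    (hf γ δ).continuous.comp (f := fun z : Dom3 => x + ρ • z) (by fun_prop)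
  have hdd : ∀ γ δ, Continuous fun z => dirDeriv z (fun y => φ y (γ, δ)) (x + ρ • z) := fun γ δ => by
    unfold dirDeriv
    have := fun k => (contDiff_pd (hf γ δ) k).continuous
    fun_prop
  have c1 : ∀ γ δ, Continuous fun z => bumpWeight z * shiftCoef z Q α β γ δ * φ (x + ρ • z) (γ, δ) :=
    fun γ δ => (hW.continuous.mul (hB γ δ).continuous).mul (hfs γ δ)
  have c2 : ∀ γ δ, Continuous fun z => bumpWeight z * (shiftAdj z p α γ * shiftAdj z p β δ)
      * (ρ * dirDeriv z (fun y => φ y (γ, δ)) (x + ρ • z)) := fun γ δ =>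
    (ha γ δ).continuous.mul (continuous_const.mul (hdd γ δ))
  have e : ∀ z, bumpWeight z * shiftForm z p Q (fun γ δ => φ (x + ρ • z) (γ, δ))
        (fun γ δ => ρ * dirDeriv z (fun y => φ y (γ, δ)) (x + ρ • z)) α β = ∑ γ, ∑ δ,
      (bumpWeight z * shiftCoef z Q α β γ δ * φ (x + ρ • z) (γ, δ)
        - bumpWeight z * (shiftAdj z p α γ * shiftAdj z p β δ)
          * (ρ * dirDeriv z (fun y => φ y (γ, δ)) (x + ρ • z))) := fun z => by
    simp only [shiftForm, Finset.mul_sum]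
    exact Finset.sum_congr rfl fun γ _ => Finset.sum_congr rfl fun δ _ => by ring
  have c12 : ∀ γ δ, Continuous fun z => bumpWeight z * shiftCoef z Q α β γ δ * φ (x + ρ • z) (γ, δ)
      - bumpWeight z * (shiftAdj z p α γ * shiftAdj z p β δ)
        * (ρ * dirDeriv z (fun y => φ y (γ, δ)) (x + ρ • z)) := fun γ δ => (c1 γ δ).sub (c2 γ δ)
  have hd : ∀ γ δ, Continuous fun z => (∑ k, pd k (fun z => bumpWeight z *
      (shiftAdj z p α γ * shiftAdj z p β δ) * z k) z) * φ (x + ρ • z) (γ, δ) := fun γ δ =>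
    (continuous_finsetSum _ fun k _ =>
      (contDiff_pd ((ha γ δ).mul (contDiff_apply ℝ ℝ k)) k).continuous).mul (hfs γ δ)
  simp only [e]
  rw [integral_finsetSum _ fun γ _ => integrableOn_unitBall
    (continuous_finsetSum _ fun δ _ => c12 γ δ)]
  refine Finset.sum_congr rfl fun γ _ => ?_
  rw [integral_finsetSum _ fun δ _ => integrableOn_unitBall (c12 γ δ)]
  refine Finset.sum_congr rfl fun δ _ => ?_
  rw [integral_sub (integrableOn_unitBall (c1 γ δ)) (integrableOn_unitBall (c2 γ δ)),
    setIntegral_mul_dirDeriv (ha γ δ) (has γ δ) (hf γ δ), sub_neg_eq_add,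
    ← integral_add (integrableOn_unitBall (c1 γ δ)) (integrableOn_unitBall (hd γ δ))]
  simp only [transportKernel, add_mul]

theorem ballTransport_apply {r : Dom3 → ℝ} {φ : Dom3 → M33} (hφ : ContDiff ℝ ∞ φ) (x : Dom3)
    (α β : Fin 3) :
    ballTransport r φ x (α, β) = ∑ γ, ∑ δ, ∫ z in Metric.closedBall 0 1,
      transportKernel z (fun i => pd i r x) (scaleHess r x) α β γ δ * φ (x + r x • z) (γ, δ) :=
  setIntegral_bumpWeight_mul_shiftForm hφ _ _ _ x α β

theorem norm_le_sum_abs (v : M33) : ‖v‖ ≤ ∑ q, |v q| := by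
  conv_lhs => rw [← (EuclideanSpace.basisFun (Fin 3 × Fin 3) ℝ).sum_repr v]
  refine (norm_sum_le _ _).trans (Finset.sum_le_sum fun q _ => ?_)
  simp [norm_smul]

theorem exists_norm_ballTransport_le (C₀ : ℝ) : ∃ C : ℝ, 0 ≤ C ∧ ∀ (r : Dom3 → ℝ) (φ : Dom3 → M33),
    ContDiff ℝ ∞ φ → ∀ x, (∀ i, |pd i r x| ≤ C₀) → (∀ i j, |scaleHess r x i j| ≤ C₀) →
      ‖ballTransport r φ x‖ ≤ C * ∫ z in Metric.closedBall 0 1, ‖φ (x + r x • z)‖ := by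
  have hK : IsCompact (Metric.closedBall (0 : Dom3) 1 ×ˢ Metric.closedBall (0 : Dom3) |C₀| ×ˢ
      Metric.closedBall (0 : Fin 3 → Dom3) |C₀|) :=
    (isCompact_closedBall _ _).prod ((isCompact_closedBall _ _).prod (isCompact_closedBall _ _))
  choose B hB using fun α β γ δ =>
    hK.exists_bound_of_continuousOn (continuous_transportKernel α β γ δ).continuousOn
  refine ⟨∑ q : Fin 3 × Fin 3, ∑ γ, ∑ δ, |B q.1 q.2 γ δ|, Finset.sum_nonneg fun _ _ =>
    Finset.sum_nonneg fun _ _ => Finset.sum_nonneg fun _ _ => abs_nonneg _, fun r φ hφ x hp hQ => ?_⟩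
  refine (norm_le_sum_abs _).trans ?_
  rw [Finset.sum_mul]
  refine Finset.sum_le_sum fun q _ => ?_
  rw [show ballTransport r φ x q = ballTransport r φ x (q.1, q.2) from rfl, ballTransport_apply hφ,
    Finset.sum_mul]
  refine (Finset.abs_sum_le_sum_abs _ _).trans (Finset.sum_le_sum fun γ _ => ?_)
  rw [Finset.sum_mul]
  refine (Finset.abs_sum_le_sum_abs _ _).trans (Finset.sum_le_sum fun δ _ => ?_)
  have hc : Continuous fun z => φ (x + r x • z) := by
    have := hφ.continuous
    fun_prop
  rw [← integral_const_mul, ← Real.norm_eq_abs]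
  have hi : IntegrableOn (fun z => |B q.1 q.2 γ δ| * ‖φ (x + r x • z)‖) (Metric.closedBall 0 1) :=
    integrableOn_unitBall (continuous_const.mul hc.norm)
  refine norm_integral_le_of_norm_le hi ?_
  filter_upwards [ae_restrict_mem Metric.isClosed_closedBall.measurableSet] with z hz
  rw [norm_mul]
  refine mul_le_mul ((hB q.1 q.2 γ δ (z, _, _) ⟨hz, ?_, ?_⟩).trans (le_abs_self _))
    (PiLp.norm_apply_le _ _) (norm_nonneg _) (abs_nonneg _)
  · rw [mem_closedBall_zero_iff, pi_norm_le_iff_of_nonneg (abs_nonneg _)]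
    exact fun i => (hp i).trans (le_abs_self _)
  · rw [mem_closedBall_zero_iff, pi_norm_le_iff_of_nonneg (abs_nonneg _)]
    intro i
    rw [pi_norm_le_iff_of_nonneg (abs_nonneg _)]
    exact fun j => (hQ i j).trans (le_abs_self _)

end TransportKernel

section TransportEstimates

theorem ballTransport_mem {r : Dom3 → ℝ} {φ : Dom3 → M33} (hr : ContDiff ℝ ∞ r)
    (hrp : PeriodicZ3 r) (hφ : φ ∈ TestClass) : ballTransport r φ ∈ TestClass :=
  shiftOp_mem (isCompact_closedBall 0 1) contDiff_bumpWeight contDiff_id hr hrp hφ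

open scoped Pointwise in
theorem setIntegral_unitBall_affine (g : Dom3 → ℝ) (x : Dom3) {ρ : ℝ} (hρ : 0 < ρ) :
    ∫ z in Metric.closedBall 0 1, g (x + ρ • z) = (ρ ^ 3)⁻¹ * ∫ y in Metric.closedBall x ρ, g y := by
  rw [Measure.setIntegral_comp_smul volume (fun y => g (x + y)) (Metric.closedBall 0 1) hρ.ne']
  have h1 : ρ • Metric.closedBall (0 : Dom3) 1 = Metric.closedBall 0 ρ := by
    rw [smul_unitClosedBall, Real.norm_of_nonneg hρ.le]
  have h2 : Metric.closedBall (0 : Dom3) ρ = (fun y => x + y) ⁻¹' Metric.closedBall x ρ := by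
    ext y
    simp
  rw [h1, h2, (measurePreserving_add_left volume x).setIntegral_preimage_emb
    (measurableEmbedding_addLeft x)]
  simp [abs_of_pos hρ]

theorem PeriodicZ3.exists_norm_fderiv_le {f : Dom3 → ℝ} (hf : ContDiff ℝ ∞ f) (hp : PeriodicZ3 f) :
    ∃ M, 0 ≤ M ∧ ∀ x, ‖fderiv ℝ f x‖ ≤ M := by
  have hc : Continuous fun x => ‖fderiv ℝ f x‖ := (hf.continuous_fderiv (by simp)).norm
  obtain ⟨M, hM⟩ := PeriodicZ3.bounded hc fun x m => by
    rw [← fderiv_comp_add_right]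
    simp only [hp _ m]
  exact ⟨M, (abs_nonneg _).trans (hM 0), fun x => (le_abs_self _).trans (hM x)⟩

theorem dirDeriv_eq_fderiv (z : Dom3) (f : Dom3 → ℝ) (x : Dom3) : dirDeriv z f x = fderiv ℝ f x z := by
  rw [clm_apply_eq_sum]
  rfl

theorem exists_norm_ballTransport_sub_le {φ : Dom3 → M33} (hφ : ContDiff ℝ ∞ φ) (hp : PeriodicZ3 φ) :
    ∃ M, 0 ≤ M ∧ ∀ (r : Dom3 → ℝ) x, 0 ≤ r x → (∀ i, pd i r x = 0) → (∀ i j, scaleHess r x i j = 0) →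
      ‖ballTransport r φ x - φ x‖ ≤ M * r x := by
  choose M hM0 hM using fun q : Fin 3 × Fin 3 =>
    (hp.coord q.1 q.2).exists_norm_fderiv_le (contDiff_coord hφ q.1 q.2)
  refine ⟨∑ q, 2 * M q, Finset.sum_nonneg fun q _ => by have := hM0 q; positivity,
    fun r x hr hp hQ => (norm_le_sum_abs _).trans ?_⟩
  rw [Finset.sum_mul]
  refine Finset.sum_le_sum fun q _ => ?_
  set f : Dom3 → ℝ := fun y => φ y (q.1, q.2) with hfdef
  have hf : ContDiff ℝ ∞ f := contDiff_coord hφ q.1 q.2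
  have hW := contDiff_bumpWeight.continuous
  have hfc := hf.continuous
  have hdd : Continuous fun z => dirDeriv z f (x + r x • z) := by
    unfold dirDeriv
    have := fun k => (contDiff_pd hf k).continuous
    fun_prop
  have e1 : ballTransport r φ x q
      = ∫ z in Metric.closedBall 0 1, bumpWeight z * (f (x + r x • z) - r x * dirDeriv z f (x + r x • z)) := by
    refine integral_congr_ae (Eventually.of_forall fun z => ?_)
    have h1 : (fun i => pd i r x) = fun _ => 0 := funext hp
    have h2 : scaleHess r x = fun _ _ => 0 := funext fun i => funext fun j => hQ i j
    simp only [shiftField, h1, h2, shiftForm_zero]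
    rfl
  have e2 : φ x q = ∫ z in Metric.closedBall 0 1, bumpWeight z * f x := by
    rw [integral_mul_const, setIntegral_bumpWeight, one_mul]
  have e3 : (ballTransport r φ x - φ x) q = ∫ z in Metric.closedBall 0 1,
      bumpWeight z * (f (x + r x • z) - f x - r x * dirDeriv z f (x + r x • z)) := by
    rw [PiLp.sub_apply, e1, e2, ← integral_sub (integrableOn_unitBall (by fun_prop))
      (integrableOn_unitBall (by fun_prop))]
    congr 1
    ext z
    ring
  rw [e3, ← Real.norm_eq_abs]
  have hi : IntegrableOn (fun z => bumpWeight z * (2 * M q * r x)) (Metric.closedBall 0 1) :=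
    integrableOn_unitBall (by fun_prop)
  refine (norm_integral_le_of_norm_le hi ?_).trans_eq ?_
  · filter_upwards [ae_restrict_mem Metric.isClosed_closedBall.measurableSet] with z hz
    have hz1 : ‖z‖ ≤ 1 := by simpa using hz
    have hw : 0 ≤ bumpWeight z := stdBump.nonneg_normed z
    rw [norm_mul, Real.norm_of_nonneg hw]
    refine mul_le_mul_of_nonneg_left ?_ hw
    have a1 : ‖f (x + r x • z) - f x‖ ≤ M q * (r x * 1) := by
      have := convex_univ.norm_image_sub_le_of_norm_fderiv_le (𝕜 := ℝ) (f := f) (C := M q)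
        (fun y _ => hf.differentiable (by simp) y) (fun y _ => hM q y) (mem_univ x)
        (mem_univ (x + r x • z))
      refine this.trans (mul_le_mul_of_nonneg_left ?_ (hM0 q))
      rw [add_sub_cancel_left, norm_smul, Real.norm_of_nonneg hr]
      gcongr
    have a2 : ‖r x * dirDeriv z f (x + r x • z)‖ ≤ r x * (M q * 1) := by
      rw [norm_mul, Real.norm_of_nonneg hr, dirDeriv_eq_fderiv]
      refine mul_le_mul_of_nonneg_left ((ContinuousLinearMap.le_opNorm _ _).trans ?_) hr
      exact mul_le_mul (hM q _) hz1 (norm_nonneg _) (hM0 q)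
    refine (norm_sub_le _ _).trans ((add_le_add a1 a2).trans_eq ?_)
    ring
  · rw [integral_mul_const, setIntegral_bumpWeight, one_mul]

end TransportEstimates

section BadBalls

variable {d : Dom3 → ℝ} {r₀ : ℝ}

/-- The mass of `d` on a closed ball (a cube, for the sup norm). -/
def ballMass (d : Dom3 → ℝ) (x : Dom3) (t : ℝ) : ℝ := ∫ y in Metric.closedBall x t, d y

theorem integrableOn_closedBall_dom3 (hd : Continuous d) (x : Dom3) (t : ℝ) :
    IntegrableOn d (Metric.closedBall x t) :=
  hd.continuousOn.integrableOn_compact (isCompact_closedBall x t)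

theorem ballMass_mono (hd : Continuous d) (h0 : ∀ x, 0 ≤ d x) (x : Dom3) {s t : ℝ} (hst : s ≤ t) :
    ballMass d x s ≤ ballMass d x t :=
  setIntegral_mono_set (integrableOn_closedBall_dom3 hd x t) (Eventually.of_forall h0)
    (Metric.closedBall_subset_closedBall hst).eventuallyLE

theorem ballMass_natCast (hd : Continuous d) (hp : PeriodicZ3 d) (x : Dom3) {n : ℕ} (hn : n ≠ 0) :
    ballMass d x n = (2 * n) ^ 3 * ∫ y in unitBox, d y := by
  have hn' : (0 : ℝ) < n := by positivity
  have h1 := setIntegral_unitBall_affine d x hn'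
  have h2 := setIntegral_unitBall_affine
    (fun y => d (((2 * n : ℕ) : ℝ) • y + (x - fun _ => (n : ℝ)))) (fun _ => 1 / 2)
    (ρ := 1 / 2) (by norm_num)
  have h3 : Metric.closedBall (fun _ => 1 / 2 : Dom3) (1 / 2) = Icc 0 1 := by
    ext z
    simp only [closedBall_pi _ (by norm_num : (0 : ℝ) ≤ 1 / 2), Real.closedBall_eq_Icc, mem_univ_pi,
      mem_Icc, Pi.le_def, forall_and]
    norm_num
  have h4 : ∀ z : Dom3, ((2 * n : ℕ) : ℝ) • ((fun _ => 1 / 2 : Dom3) + (1 / 2 : ℝ) • z) +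
      (x - fun _ => (n : ℝ)) = x + (n : ℝ) • z := by
    intro z
    ext i
    simp
    ring
  rw [h3, ← restrict_unitBox, setIntegral_unitBox_scale hd hp (by positivity)] at h2
  simp only [h4] at h2
  rw [h2] at h1
  rw [ballMass, eq_inv_mul_iff_mul_eq₀ (by positivity)] at *
  rw [← h1]
  ring

theorem ballMass_add_int (hp : PeriodicZ3 d) (x : Dom3) (m : Fin 3 → ℤ) (t : ℝ) :
    ballMass d (x + fun i => (m i : ℝ)) t = ballMass d x t := by
  have h := (measurePreserving_add_right volume (fun i => (m i : ℝ) : Dom3)).setIntegral_preimage_emb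
    (measurableEmbedding_addRight _) d (Metric.closedBall (x + fun i => (m i : ℝ)) t)
  have h2 : (fun y : Dom3 => y + fun i => (m i : ℝ)) ⁻¹'
      Metric.closedBall (x + fun i => (m i : ℝ)) t = Metric.closedBall x t := by
    ext y
    simp
  rw [ballMass, ← h, h2]
  simp only [hp _ m]
  rfl

/-- Balls of radius at most one carrying a large average of `d`. -/
def BadBall (d : Dom3 → ℝ) (y : Dom3) (t : ℝ) : Prop := 0 < t ∧ t ≤ 1 ∧ t ^ 3 < ballMass d y t

/-- A Lipschitz radius exceeding the radius of every bad ball near its centre. -/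
def badScale (d : Dom3 → ℝ) (r₀ : ℝ) (x : Dom3) : ℝ :=
  sSup (insert r₀ {τ | ∃ y t, BadBall d y t ∧ τ = t - ‖x - y‖ / 4})

/-- The union of the enlarged bad balls of radius larger than `r₀`. -/
def badSet (d : Dom3 → ℝ) (r₀ : ℝ) : Set Dom3 :=
  {x | ∃ y t, BadBall d y t ∧ r₀ < t ∧ ‖x - y‖ < 7 * t}

theorem bddAbove_badScale (hr : r₀ ≤ 1) (x : Dom3) :
    BddAbove (insert r₀ {τ | ∃ y t, BadBall d y t ∧ τ = t - ‖x - y‖ / 4}) := by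
  refine ⟨1, ?_⟩
  rintro _ (rfl | ⟨y, t, ht, rfl⟩)
  · exact hr
  · have := norm_nonneg (x - y)
    linarith [ht.2.1]

theorem le_badScale (hr : r₀ ≤ 1) (x : Dom3) : r₀ ≤ badScale d r₀ x :=
  le_csSup (bddAbove_badScale hr x) (mem_insert _ _)

theorem BadBall.le_badScale (hr : r₀ ≤ 1) (x : Dom3) {y : Dom3} {t : ℝ} (h : BadBall d y t) :
    t - ‖x - y‖ / 4 ≤ badScale d r₀ x :=
  le_csSup (bddAbove_badScale hr x) (mem_insert_of_mem _ ⟨y, t, h, rfl⟩)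

theorem badScale_le {x : Dom3} {c : ℝ} (hr : r₀ ≤ c)
    (h : ∀ y t, BadBall d y t → t - ‖x - y‖ / 4 ≤ c) : badScale d r₀ x ≤ c := by
  refine csSup_le (insert_nonempty _ _) ?_
  rintro _ (rfl | ⟨y, t, ht, rfl⟩)
  · exact hr
  · exact h y t ht

theorem badScale_le_one (hr : r₀ ≤ 1) (x : Dom3) : badScale d r₀ x ≤ 1 :=
  badScale_le hr fun y t h => by linarith [h.2.1, norm_nonneg (x - y)]

theorem badScale_le_add (hr : r₀ ≤ 1) (x y : Dom3) :
    badScale d r₀ x ≤ badScale d r₀ y + ‖x - y‖ / 4 := by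
  refine badScale_le ?_ fun z t h => ?_
  · linarith [le_badScale (d := d) hr y, norm_nonneg (x - y)]
  · have h1 := h.le_badScale hr y
    have h2 : ‖y - z‖ ≤ ‖x - y‖ + ‖x - z‖ := by
      rw [norm_sub_rev x y]
      simpa using norm_add_le (y - x) (x - z)
    linarith

theorem BadBall.add_int (hp : PeriodicZ3 d) {y : Dom3} {t : ℝ} (h : BadBall d y t) (m : Fin 3 → ℤ) :
    BadBall d (y + fun i => (m i : ℝ)) t :=
  ⟨h.1, h.2.1, by rw [ballMass_add_int hp]; exact h.2.2⟩

theorem periodic_badScale (hp : PeriodicZ3 d) (hr : r₀ ≤ 1) : PeriodicZ3 (badScale d r₀) := by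
  have key : ∀ x (m : Fin 3 → ℤ), badScale d r₀ x ≤ badScale d r₀ (x + fun i => (m i : ℝ)) :=
    fun x m => badScale_le (le_badScale hr _) fun y t h => by
      simpa using (h.add_int hp m).le_badScale hr (x + fun i => (m i : ℝ))
  intro x m
  refine le_antisymm ?_ (key x m)
  have h := key (x + fun i => (m i : ℝ)) (-m)
  have e : (x + (fun i => (m i : ℝ)) + fun i => (((-m) i : ℤ) : ℝ) : Dom3) = x := by
    rw [add_assoc]
    ext i
    simp
  rwa [e] at h

theorem ballMass_le_of_badScale_lt (hr₀ : 0 < r₀) (hr : r₀ ≤ 1) {x : Dom3} {ρ : ℝ}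
    (h : badScale d r₀ x < ρ) (hρ : ρ ≤ 1) : ballMass d x ρ ≤ ρ ^ 3 := by
  by_contra! hc
  have hb : BadBall d x ρ := ⟨hr₀.trans_le ((le_badScale hr x).trans h.le), hρ, hc⟩
  have := hb.le_badScale hr x
  simp at this
  linarith

theorem isOpen_badSet : IsOpen (badSet d r₀) := by
  have : badSet d r₀ = ⋃ (y : Dom3) (t : ℝ) (_ : BadBall d y t ∧ r₀ < t), Metric.ball y (7 * t) := by
    ext x
    simp [badSet, dist_eq_norm, and_assoc]
  rw [this]
  exact isOpen_iUnion fun _ => isOpen_iUnion fun _ => isOpen_iUnion fun _ => Metric.isOpen_ball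

theorem badScale_eq_of_notMem_badSet (hr₀ : 0 < r₀) (hr : r₀ ≤ 1) {x : Dom3} (hx : x ∉ badSet d r₀)
    {y : Dom3} (hy : ‖y - x‖ < 2 * r₀) : badScale d r₀ y = r₀ := by
  refine le_antisymm (badScale_le le_rfl fun z t h => ?_) (le_badScale hr y)
  by_contra! hc
  refine hx ⟨z, t, h, by linarith [norm_nonneg (y - z)], ?_⟩
  have h1 : ‖x - z‖ ≤ ‖y - x‖ + ‖y - z‖ := by
    rw [norm_sub_rev y x]
    simpa using norm_add_le (x - y) (y - z)
  linarith [norm_nonneg (y - z)]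

theorem volume_badSet_inter_le (hd : Continuous d) (h0 : ∀ x, 0 ≤ d x) (hp : PeriodicZ3 d)
    {ε : ℝ} (hε : ∫ x in unitBox, d x ≤ ε) :
    volume (badSet d r₀ ∩ unitBox) ≤ ENNReal.ofReal (56 ^ 3 * 18 ^ 3 * ε) := by
  set T : Set (Dom3 × ℝ) := {a | BadBall d a.1 a.2 ∧ r₀ < a.2 ∧ ‖a.1‖ ≤ 8} with hT
  obtain ⟨u, huT, hdisj, hcov⟩ := Vitali.exists_disjoint_subfamily_covering_enlargement_closedBall
    T (fun a => a.1) (fun a => 7 * a.2) 7 (fun a ha => by linarith [ha.1.2.1]) 4 (by norm_num)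
  have hpos : ∀ a ∈ u, 0 < a.2 := fun a ha => (huT ha).1.1
  have hucount : u.Countable := hdisj.countable_of_nonempty_interior fun a ha => by
    refine ⟨a.1, ?_⟩
    refine Metric.ball_subset_interior_closedBall (Metric.mem_ball_self ?_)
    linarith [hpos a ha]
  have hsub : badSet d r₀ ∩ unitBox ⊆ ⋃ a ∈ u, Metric.closedBall a.1 (4 * (7 * a.2)) := by
    rintro x ⟨⟨y, t, hb, hrt, hxy⟩, hx⟩
    have hx1 : ‖x‖ ≤ 1 := by
      rw [pi_norm_le_iff_of_nonneg zero_le_one]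
      intro i
      have := hx i (mem_univ i)
      rw [Real.norm_of_nonneg this.1]
      exact this.2.le
    have hy : ‖y‖ ≤ 8 := by
      have : ‖y‖ ≤ ‖x‖ + ‖x - y‖ := by simpa using norm_sub_le x (x - y)
      linarith [hb.2.1]
    obtain ⟨b, hbu, hb2⟩ := hcov (y, t) ⟨hb, hrt, hy⟩
    refine mem_iUnion₂.mpr ⟨b, hbu, hb2 ?_⟩
    rw [Metric.mem_closedBall, dist_eq_norm]
    exact hxy.le
  set ν : Measure Dom3 := volume.withDensity fun x => ENNReal.ofReal (d x) with hν
  have hνball : ∀ (y : Dom3) (t : ℝ), ν (Metric.closedBall y t) = ENNReal.ofReal (ballMass d y t) := by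
    intro y t
    rw [hν, withDensity_apply _ Metric.isClosed_closedBall.measurableSet, ballMass,
      ofReal_integral_eq_lintegral_ofReal (integrableOn_closedBall_dom3 hd y t)
        (Eventually.of_forall h0)]
  calc volume (badSet d r₀ ∩ unitBox)
      ≤ volume (⋃ a ∈ u, Metric.closedBall a.1 (4 * (7 * a.2))) := measure_mono hsub
    _ ≤ ∑' a : u, volume (Metric.closedBall a.1.1 (4 * (7 * a.1.2))) :=
        measure_biUnion_le _ hucount _
    _ ≤ ∑' a : u, ENNReal.ofReal (56 ^ 3) * ν (Metric.closedBall a.1.1 a.1.2) := by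
        refine ENNReal.tsum_le_tsum fun a => ?_
        have hapos := hpos a.1 a.2
        rw [hνball, ← ENNReal.ofReal_mul (by norm_num), ← ofReal_measureReal
          measure_closedBall_lt_top.ne, volume_real_closedBall_dom3 _ (by linarith)]
        refine ENNReal.ofReal_le_ofReal ?_
        have := (huT a.2).1.2.2
        nlinarith
    _ = ENNReal.ofReal (56 ^ 3) * ∑' a : u, ν (Metric.closedBall a.1.1 a.1.2) :=
        ENNReal.tsum_mul_left
    _ = ENNReal.ofReal (56 ^ 3) * ν (⋃ a ∈ u, Metric.closedBall a.1 a.2) := by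
        rw [measure_biUnion hucount _ fun a _ => Metric.isClosed_closedBall.measurableSet]
        refine hdisj.mono_on fun a ha => ?_
        exact Metric.closedBall_subset_closedBall (by linarith [hpos a ha])
    _ ≤ ENNReal.ofReal (56 ^ 3) * ν (Metric.closedBall 0 (9 : ℕ)) := by
        gcongr
        refine iUnion₂_subset fun a ha => Metric.closedBall_subset_closedBall' ?_
        have := huT ha
        rw [dist_zero_right]
        push_cast
        linarith [this.1.2.1, this.2.2]
    _ ≤ ENNReal.ofReal (56 ^ 3 * 18 ^ 3 * ε) := by
        rw [hνball, ← ENNReal.ofReal_mul (by norm_num), ballMass_natCast hd hp 0 (by norm_num)]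
        refine ENNReal.ofReal_le_ofReal ?_
        norm_num
        linarith

end BadBalls

section Truncation

/-- Truncation of test fields: a field that is bounded up to an error of small mass is close, off
a small set, to a uniformly bounded test field. -/
theorem exists_truncation (L : ℝ) : ∃ C : ℝ, 0 ≤ C ∧
    ∀ φ ∈ TestClass, ∀ d : Dom3 → ℝ, Continuous d → PeriodicZ3 d → (∀ x, 0 ≤ d x) →
    (∀ x, ‖φ x‖ ≤ d x + L) → ∀ ε ≤ (1 : ℝ), ∫ x in unitBox, d x ≤ ε → ∀ δ > (0 : ℝ),
    ∃ ψ ∈ TestClass, (∀ x, ‖ψ x‖ ≤ C) ∧ ∃ A : Set Dom3, MeasurableSet A ∧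
      volume (A ∩ unitBox) ≤ ENNReal.ofReal (C * ε) ∧ ∀ x ∉ A, ‖ψ x - φ x‖ ≤ δ := by
  obtain ⟨C₀, hC₀, hscale⟩ := exists_smooth_scale
  obtain ⟨C₁, hC₁, hbound⟩ := exists_norm_ballTransport_le C₀
  obtain ⟨n, hn⟩ := exists_nat_ge C₀
  have hn1 : (1 : ℝ) ≤ n := hC₀.trans hn
  have hn0 : n ≠ 0 := by
    rintro rfl
    norm_num at hn1
  refine ⟨max (C₁ * ((2 * n) ^ 3 + 8 * L)) (56 ^ 3 * 18 ^ 3), le_max_of_le_right (by norm_num), ?_⟩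
  intro φ hφ d hd hp h0 hφd ε hε1 hε δ hδ
  have hε0 : 0 ≤ ε := (integral_nonneg h0).trans hε
  obtain ⟨M, hM, happrox⟩ := exists_norm_ballTransport_sub_le hφ.1 hφ.2.1
  set r₀ : ℝ := min 1 (δ / (M * C₀ + 1)) with hr₀def
  have hr₀ : 0 < r₀ := by positivity
  have hr₁ : r₀ ≤ 1 := min_le_left _ _
  have hMr : M * (C₀ * r₀) ≤ δ := by
    have h1 : r₀ ≤ δ / (M * C₀ + 1) := min_le_right _ _
    rw [le_div_iff₀ (by positivity)] at h1
    nlinarith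
  obtain ⟨r, hrc, hrp, hr2, hrC, hr3, hr4, hr5⟩ := hscale (badScale d r₀) r₀ hr₀
    (le_badScale hr₁) (badScale_le_one hr₁) (badScale_le_add hr₁) (periodic_badScale hp hr₁)
  have hR0 : ∀ x, 0 < badScale d r₀ x := fun x => hr₀.trans_le (le_badScale hr₁ x)
  have hrpos : ∀ x, 0 < r x := fun x => by linarith [hr2 x, hR0 x]
  refine ⟨ballTransport r φ, ballTransport_mem hrc hrp hφ, fun x => ?_, badSet d r₀,
    isOpen_badSet.measurableSet, ?_, fun x hx => ?_⟩
  · have hmass : (r x ^ 3)⁻¹ * ballMass d x (r x) ≤ (2 * n) ^ 3 := by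
      rw [inv_mul_le_iff₀ (by have := hrpos x; positivity)]
      rcases le_or_gt (r x) 1 with h | h
      · have h1 := ballMass_le_of_badScale_lt hr₀ hr₁ (by linarith [hr2 x, hR0 x]) h
        have h2 : (1 : ℝ) ≤ (2 * n) ^ 3 := one_le_pow₀ (by linarith)
        have h3 : 0 ≤ r x ^ 3 := by have := hrpos x; positivity
        nlinarith
      · have h1 : r x ≤ n := by
          have := mul_le_mul_of_nonneg_left (badScale_le_one (d := d) hr₁ x) (by linarith : 0 ≤ C₀)
          linarith [hrC x]
        have h2 := ballMass_mono hd h0 x h1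
        rw [ballMass_natCast hd hp x hn0] at h2
        have h3 : (1 : ℝ) ≤ r x ^ 3 := one_le_pow₀ h.le
        have h4 : (2 * n : ℝ) ^ 3 * ∫ y in unitBox, d y ≤ (2 * n) ^ 3 * 1 := by
          gcongr
          exact hε.trans hε1
        have h5 : (0 : ℝ) ≤ (2 * n) ^ 3 := by positivity
        nlinarith
    have hcont : Continuous fun z => d (x + r x • z) := by fun_prop
    refine le_trans (hbound r φ hφ.1 x (hr3 x) (hr4 x)) (le_trans ?_ (le_max_left _ _))
    refine mul_le_mul_of_nonneg_left ?_ hC₁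
    calc ∫ z in Metric.closedBall 0 1, ‖φ (x + r x • z)‖
        ≤ ∫ z in Metric.closedBall 0 1, (d (x + r x • z) + L) := by
          refine integral_mono ?_ ?_ fun z => hφd _
          · have := hφ.1.continuous
            exact integrableOn_unitBall (by fun_prop)
          · exact integrableOn_unitBall (by fun_prop)
      _ = (r x ^ 3)⁻¹ * ballMass d x (r x) + 8 * L := by
          rw [integral_add (integrableOn_unitBall hcont)
            (integrableOn_unitBall continuous_const), setIntegral_unitBall_affine d x (hrpos x)]
          rw [setIntegral_const, volume_real_closedBall_dom3 _ zero_le_one, smul_eq_mul, ballMass]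
          norm_num
      _ ≤ (2 * n) ^ 3 + 8 * L := by linarith
  · refine (volume_badSet_inter_le hd h0 hp hε).trans (ENNReal.ofReal_le_ofReal ?_)
    exact mul_le_mul_of_nonneg_right (le_max_right _ _) hε0
  · obtain ⟨h1, h2⟩ := hr5 x fun y hy => badScale_eq_of_notMem_badSet hr₀ hr₁ hx hy
    refine (happrox r x (hrpos x).le h1 h2).trans (le_trans ?_ hMr)
    have h3 : badScale d r₀ x = r₀ :=
      badScale_eq_of_notMem_badSet hr₀ hr₁ hx (by simpa using hr₀)
    have := hrC x
    rw [h3] at this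
    exact mul_le_mul_of_nonneg_left this hM

end Truncation

section HullInclusion

variable {K : Set M33}

theorem IsCompact.exists_norm_le_infDist_add (hne : K.Nonempty) (hK : IsCompact K) :
    ∃ B, 0 ≤ B ∧ ∀ η, ‖η‖ ≤ Metric.infDist η K + B := by
  obtain ⟨B, hB⟩ := hK.isBounded.exists_norm_le
  obtain ⟨k₀, hk₀⟩ := hne
  refine ⟨B, (norm_nonneg _).trans (hB k₀ hk₀), fun η => ?_⟩
  obtain ⟨k, hk, he⟩ := hK.exists_infDist_eq_dist ⟨k₀, hk₀⟩ η
  rw [he, dist_eq_norm]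
  have : ‖η‖ ≤ ‖η - k‖ + ‖k‖ := by simpa using norm_add_le (η - k) k
  linarith [hB k hk]

theorem le_add_rpow_mul_rpow {e a p : ℝ} (he : 0 < e) (ha : 0 ≤ a) (hp : 1 ≤ p) :
    a ≤ e + e ^ (1 - p) * a ^ p := by
  have h2 : 0 ≤ e ^ (1 - p) * a ^ p := by positivity
  rcases le_or_gt a e with h | h
  · linarith
  · have ha' : 0 < a := he.trans h
    have h1 : a ^ (1 - p) ≤ e ^ (1 - p) :=
      Real.rpow_le_rpow_of_nonpos he h.le (by linarith)
    have h3 : a ^ (1 - p) * a ^ p = a := by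
      rw [← Real.rpow_add ha']
      simp
    have h4 : a ^ (1 - p) * a ^ p ≤ e ^ (1 - p) * a ^ p := by gcongr
    linarith

theorem exists_integral_infDist_le {p : ℝ} (hp : 1 ≤ p) {ξ : M33} (hξ : ξ ∈ hullP K p) {ε : ℝ}
    (hε : 0 < ε) : ∃ φ ∈ TestClass, ∫ x in unitBox, Metric.infDist (ξ + φ x) K ≤ ε := by
  have he : 0 < ε / 2 := by positivity
  obtain ⟨φ, hφ, hlt⟩ := exists_lt_of_sdqcEnvelope_lt (c := (ε / 2) ^ p)
    (by rw [hξ.2]; positivity)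
  refine ⟨φ, hφ, ?_⟩
  have hc := hφ.1.continuous
  have hd : Continuous fun x => Metric.infDist (ξ + φ x) K :=
    (Metric.continuous_infDist_pt K).comp (continuous_const.add hc)
  have hdp : Continuous fun x => Metric.infDist (ξ + φ x) K ^ p :=
    hd.rpow_const fun _ => Or.inr (by linarith)
  have hi : Integrable (fun x => (ε / 2) ^ (1 - p) * Metric.infDist (ξ + φ x) K ^ p)
      (volume.restrict unitBox) := (integrableOn_unitBox hdp).const_mul _
  calc ∫ x in unitBox, Metric.infDist (ξ + φ x) K
      ≤ ∫ x in unitBox, (ε / 2 + (ε / 2) ^ (1 - p) * Metric.infDist (ξ + φ x) K ^ p) :=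
        integral_mono (integrableOn_unitBox hd) ((integrable_const _).add hi) fun x =>
          le_add_rpow_mul_rpow he Metric.infDist_nonneg hp
    _ = ε / 2 + (ε / 2) ^ (1 - p) * ∫ x in unitBox, Metric.infDist (ξ + φ x) K ^ p := by
        rw [integral_add (integrable_const _) hi, integral_const_mul]
        simp
    _ ≤ ε / 2 + (ε / 2) ^ (1 - p) * (ε / 2) ^ p := by gcongr
    _ = ε := by
        rw [← Real.rpow_add he]
        simp

theorem IsCompact.exists_infDist_le_imp_le_add (hne : K.Nonempty) (hK : IsCompact K) {g : M33 → ℝ}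
    (hg : Continuous g) (ρ : ℝ) {κ : ℝ} (hκ : 0 < κ) :
    ∃ δ > 0, ∀ η, ‖η‖ ≤ ρ → Metric.infDist η K ≤ δ → g η ≤ sSup (g '' K) + κ := by
  have hS : IsCompact (Metric.closedBall (0 : M33) ρ ∩ {η | sSup (g '' K) + κ ≤ g η}) :=
    (isCompact_closedBall 0 ρ).inter_right (isClosed_le continuous_const hg)
  obtain ⟨m, hm, h⟩ := hS.exists_forall_le' (a := 0)
    (Metric.continuous_infDist_pt K).continuousOn fun η hη => by
      refine lt_of_le_of_ne Metric.infDist_nonneg fun h => ?_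
      have hηK : η ∈ K := (hK.isClosed.mem_iff_infDist_zero hne).mpr h.symm
      have h1 := le_csSup (hK.image hg).bddAbove (mem_image_of_mem g hηK)
      have h2 : sSup (g '' K) + κ ≤ g η := hη.2
      linarith
  refine ⟨m / 2, by positivity, fun η hη hd => ?_⟩
  by_contra! hc
  have := h η ⟨by simpa using hη, hc.le⟩
  linarith

theorem hullP_subset_hullInf (hne : K.Nonempty) (hK : IsCompact K) {p : ℝ} (hp : 1 ≤ p) :
    hullP K p ⊆ hullInf K := by
  intro ξ hξ
  refine ⟨hξ.1, fun g hg hg0 hqc => ?_⟩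
  have hS : 0 ≤ sSup (g '' K) := Real.sSup_nonneg (by rintro _ ⟨η, -, rfl⟩; exact hg0 η)
  obtain ⟨B, hB, hBK⟩ := hK.exists_norm_le_infDist_add hne
  obtain ⟨C, hC, htrunc⟩ := exists_truncation (B + ‖ξ‖)
  obtain ⟨G, hG⟩ := (isCompact_closedBall (0 : M33) (‖ξ‖ + C)).exists_bound_of_continuousOn
    hg.continuousOn
  have hG0 : 0 ≤ G := (norm_nonneg _).trans (hG 0 (Metric.mem_closedBall_self (by positivity)))
  refine le_of_forall_pos_le_add fun κ' hκ' => ?_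
  set κ := κ' / 2 with hκdef
  have hκ : 0 < κ := by positivity
  obtain ⟨δ, hδ, hgδ⟩ := hK.exists_infDist_le_imp_le_add hne hg (‖ξ‖ + C) hκ
  set ε : ℝ := min 1 (κ / (G * (C + 2 / δ) + 1)) with hεdef
  have hε : 0 < ε := by positivity
  have hεκ : G * (C * ε) + G * (2 / δ * ε) ≤ κ := by
    have h1 : ε ≤ κ / (G * (C + 2 / δ) + 1) := min_le_right _ _
    rw [le_div_iff₀ (by positivity)] at h1
    linarith
  obtain ⟨φ, hφ, hint⟩ := exists_integral_infDist_le hp hξ hε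
  set d : Dom3 → ℝ := fun x => Metric.infDist (ξ + φ x) K with hd
  have hdc : Continuous d :=
    (Metric.continuous_infDist_pt K).comp (continuous_const.add hφ.1.continuous)
  obtain ⟨ψ, hψ, hψC, A, hA, hAε, hAδ⟩ := htrunc φ hφ d hdc
    (fun x m => by simp only [hd, hφ.2.1 x m]) (fun x => Metric.infDist_nonneg)
    (fun x => by
      have h1 : ‖φ x‖ ≤ ‖ξ + φ x‖ + ‖ξ‖ := by simpa using norm_sub_le (ξ + φ x) ξ
      linarith [hBK (ξ + φ x)])
    ε (min_le_left _ _) hint (δ / 2) (by positivity)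
  have hball : ∀ x, ‖ξ + ψ x‖ ≤ ‖ξ‖ + C := fun x =>
    (norm_add_le _ _).trans (by linarith [hψC x])
  have hpt : ∀ x, g (ξ + ψ x) ≤
      (sSup (g '' K) + κ) + (A.indicator (fun _ => G) x + G * (2 / δ * d x)) := by
    intro x
    have hd0 : 0 ≤ d x := Metric.infDist_nonneg
    have h3 : 0 ≤ G * (2 / δ * d x) := by positivity
    have hgG : g (ξ + ψ x) ≤ G :=
      (le_abs_self _).trans (hG _ (by simpa using hball x))
    by_cases hx : x ∈ A
    · rw [indicator_of_mem hx]
      linarith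
    · rw [indicator_of_notMem hx]
      rcases le_or_gt (d x) (δ / 2) with h | h
      · have h1 : Metric.infDist (ξ + ψ x) K ≤ δ := by
          have h2 := Metric.infDist_le_infDist_add_dist (s := K) (x := ξ + ψ x) (y := ξ + φ x)
          rw [dist_add_left, dist_eq_norm] at h2
          have h4 : Metric.infDist (ξ + φ x) K ≤ δ / 2 := h
          linarith [hAδ x hx]
        linarith [hgδ _ (hball x) h1]
      · have h1 : 1 ≤ 2 / δ * d x := by
          rw [div_mul_eq_mul_div, le_div_iff₀ hδ]
          linarith
        have := mul_le_mul_of_nonneg_left h1 hG0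
        linarith
  have hi1 : Integrable (A.indicator fun _ => G) (volume.restrict unitBox) :=
    (integrable_const G).indicator hA
  have hi2 : Integrable (fun x => G * (2 / δ * d x)) (volume.restrict unitBox) :=
    ((integrableOn_unitBox hdc).const_mul _).const_mul _
  have hi3 : Integrable (fun x => A.indicator (fun _ => G) x + G * (2 / δ * d x))
      (volume.restrict unitBox) := hi1.add hi2
  have hAreal : (volume.restrict unitBox).real A ≤ C * ε := by
    rw [measureReal_restrict_apply hA]
    exact ENNReal.toReal_le_of_le_ofReal (by positivity) hAε
  calc g ξ ≤ ∫ x in unitBox, g (ξ + ψ x) := hqc ξ hξ.1 ψ hψ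
    _ ≤ ∫ x in unitBox,
        ((sSup (g '' K) + κ) + (A.indicator (fun _ => G) x + G * (2 / δ * d x))) :=
        integral_mono (integrableOn_unitBox (hg.comp (continuous_const.add hψ.1.continuous)))
          ((integrable_const _).add hi3) hpt
    _ = (sSup (g '' K) + κ) + ((volume.restrict unitBox).real A * G +
        G * (2 / δ * ∫ x in unitBox, d x)) := by
        rw [integral_add (integrable_const _) hi3, integral_add hi1 hi2,
          integral_const_mul, integral_const_mul, integral_indicator_const G hA]
        simp
    _ ≤ (sSup (g '' K) + κ) + (C * ε * G + G * (2 / δ * ε)) := by gcongr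
    _ ≤ sSup (g '' K) + κ' := by linarith

end HullInclusion

end Helpers

/-- For every non-empty compact `K ⊆ Sym(3)` and every
`1 ≤ p < ∞`, the `p`-symmetric div-quasiconvex hull coincides with the
∞-symmetric div-quasiconvex hull; in particular all the hulls `K^(p)`,
`1 ≤ p ≤ ∞`, coincide. -/
theorem symmetric_divQC_hull_p_eq_infty (K : Set M33) (hne : K.Nonempty)
    (hcomp : IsCompact K) (hsym : ∀ A ∈ K, IsSym3 A) :
    ∀ p : ℝ, 1 ≤ p → hullP K p = hullInf K := by
  exact fun _ hp => (hullP_subset_hullInf hne hcomp hp).antisymm (hullInf_subset_hullP hne hp)
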